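/- For every integer N > 1 and every real number x, the twisted spin-one XXZ Hamiltonian H on (ℂ³)^{⊗N} with twist angle φ = π possesses a nonzero vector v satisfying H v = 0, Σ v = 0, and S' v = (−1)^{N+1} v; that is, H has a zero-energy eigenstate of zero total magnetisation lying in the eigenspace of the twisted translation operator S' with eigenvalue (−1)^{N+1}. -/

import Mathlib

open Matrix BigOperators Finset

noncomputable section


/-- The spin-one matrices s¹, s², s³ in the ordered basis (⇑, 0, ⇓). -/
def sMat : Fin 3 → Matrix (Fin 3) (Fin 3) ℂ :=
  ![((Real.sqrt 2 : ℂ))⁻¹ • !![0,1,0; 1,0,1; 0,1,0],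
    ((Real.sqrt 2 : ℂ))⁻¹ • !![0,-Complex.I,0; Complex.I,0,-Complex.I; 0,Complex.I,0],
    !![1,0,0; 0,0,0; 0,0,-1]]

/-- A single-site operator `m` acting on the j-th factor of `(ℂ³)^{⊗N}`. -/
def siteOp {N : ℕ} (m : Matrix (Fin 3) (Fin 3) ℂ) (j : Fin N) :
    Matrix (Fin N → Fin 3) (Fin N → Fin 3) ℂ :=
  Matrix.of fun σ τ => m (σ j) (τ j) * if ∀ k, k ≠ j → σ k = τ k then 1 else 0

/-- `s_j^a` (indices: a = 0,1,2 for s¹,s²,s³; site j is 0-indexed). -/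
def sAt {N : ℕ} (a : Fin 3) (j : Fin N) : Matrix (Fin N → Fin 3) (Fin N → Fin 3) ℂ :=
  siteOp (sMat a) j

/-- `s_{j+1}^a` with the twisted boundary conditions for twist angle φ = π:
`s_{N+1}¹ = −s₁¹`, `s_{N+1}² = −s₁²`, `s_{N+1}³ = s₁³`. -/
def sNext {N : ℕ} (a : Fin 3) (j : Fin N) : Matrix (Fin N → Fin 3) (Fin N → Fin 3) ℂ :=
  if h : (j : ℕ) + 1 < N then siteOp (sMat a) ⟨(j : ℕ) + 1, h⟩
  else (if a = 2 then (1 : ℂ) else -1) • siteOp (sMat a) ⟨0, j.pos⟩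

/-- Couplings J₁ = J₂ = 1, J₃ = (x²−2)/2. -/
def Jc (x : ℝ) : Fin 3 → ℂ := ![1, 1, ((x : ℂ)^2 - 2)/2]

/-- The symmetric coupling matrix A with A_{aa} = J_a, A₁₂ = 1, A₁₃ = A₂₃ = x − 1. -/
def Ac (x : ℝ) : Fin 3 → Fin 3 → ℂ :=
  ![![1, 1, (x : ℂ) - 1], ![1, 1, (x : ℂ) - 1],
    ![(x : ℂ) - 1, (x : ℂ) - 1, ((x : ℂ)^2 - 2)/2]]

/-- The twisted spin-one XXZ Hamiltonian (twist angle φ = π). -/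
def Hxxz (N : ℕ) (x : ℝ) : Matrix (Fin N → Fin 3) (Fin N → Fin 3) ℂ :=
  ∑ j : Fin N,
    ((∑ a : Fin 3, Jc x a • (sAt a j * sNext a j + (2 : ℂ) • (sAt a j * sAt a j)))
      - ∑ a : Fin 3, ∑ b : Fin 3,
          Ac x a b • (sAt a j * sAt b j * sNext a j * sNext b j))

/-- Total magnetisation Σ = ∑_j s_j³. -/
def magnetisation (N : ℕ) : Matrix (Fin N → Fin 3) (Fin N → Fin 3) ℂ :=
  ∑ j : Fin N, sAt 2 j

/-- Twisted translation operator `S'` with diagonal twist `d`: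
`S'(v₁⊗…⊗v_N) = (Ω v_N)⊗v₁⊗…⊗v_{N−1}` where `Ω = diag d`. -/
def Sprime (N : ℕ) (d : Fin 3 → ℂ) : Matrix (Fin N → Fin 3) (Fin N → Fin 3) ℂ :=
  Matrix.of fun σ τ =>
    if τ = fun j => σ (finRotate N j) then
      ∏ j : Fin N, (if (finRotate N j : Fin N).val = 0 then d (τ j) else 1)
    else 0

/-- The diagonal entries of the twist `Ω`. -/
def twist : Fin 3 → ℝ := ![-1, 1, -1]

/-- The matrix elements of the local supercharge `q : V → V ⊗ V`, where
`charge y a b c = ⟨b ⊗ c, q a⟩`. -/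
def charge (y : ℝ) : Fin 3 → Fin 3 → Fin 3 → ℝ :=
  ![![![0, -y, 0], ![y, 0, 0], ![0, 0, 0]],
    ![![0, 0, 1], ![0, 0, 0], ![-1, 0, 0]],
    ![![0, 0, 0], ![0, 0, -y], ![0, y, 0]]]

/-- A function on words is twisted cyclic if it is invariant under the signed twisted
rotation of words. -/
def TwistedCyclic (φ : List (Fin 3) → ℝ) : Prop :=
  ∀ a l, φ (a :: l) = (-1) ^ l.length * twist a * φ (l ++ [a])

/-- The adjoint supercharge `∑ⱼ (-1)ʲ q†ⱼ` of the open chain, evaluated at a word. -/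
def del (y : ℝ) : List (Fin 3) → (List (Fin 3) → ℝ) → ℝ
  | [], _ => 0
  | a :: l, φ => (∑ b, ∑ c, charge y a b c * φ (b :: c :: l)) - del y l fun m => φ (a :: m)

/-- The supercharge `∑ⱼ (-1)ʲ qⱼ` of the open chain, evaluated at a word. -/
def ins (y : ℝ) : List (Fin 3) → (List (Fin 3) → ℝ) → ℝ
  | [], _ => 0
  | [_], _ => 0
  | a :: b :: l, φ =>
    (∑ c, charge y c a b * φ (c :: l)) - ins y (b :: l) fun m => φ (a :: m)

section Linearity

variable (y : ℝ)

@[simp] lemma del_nil (φ : List (Fin 3) → ℝ) : del y [] φ = 0 := rfl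

lemma del_cons (a : Fin 3) (l : List (Fin 3)) (φ : List (Fin 3) → ℝ) :
    del y (a :: l) φ =
      (∑ b, ∑ c, charge y a b c * φ (b :: c :: l)) - del y l fun m => φ (a :: m) := rfl

@[simp] lemma ins_nil (φ : List (Fin 3) → ℝ) : ins y [] φ = 0 := rfl

@[simp] lemma ins_singleton (a : Fin 3) (φ : List (Fin 3) → ℝ) : ins y [a] φ = 0 := rfl

lemma ins_cons_cons (a b : Fin 3) (l : List (Fin 3)) (φ : List (Fin 3) → ℝ) :
    ins y (a :: b :: l) φ =
      (∑ c, charge y c a b * φ (c :: l)) - ins y (b :: l) fun m => φ (a :: m) := rfl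

lemma del_congr (x : List (Fin 3)) : ∀ {φ ψ : List (Fin 3) → ℝ},
    (∀ w : List (Fin 3), w.length = x.length + 1 → φ w = ψ w) → del y x φ = del y x ψ := by
  induction x with
  | nil => simp
  | cons a l ih =>
    intro φ ψ h
    rw [del_cons, del_cons, ih fun w hw => h (a :: w) (by simpa using hw)]
    congr 1
    exact Finset.sum_congr rfl fun b _ => Finset.sum_congr rfl fun c _ => by
      rw [h (b :: c :: l) (by simp)]

lemma del_add (x : List (Fin 3)) : ∀ φ ψ : List (Fin 3) → ℝ,
    del y x (fun w => φ w + ψ w) = del y x φ + del y x ψ := by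
  induction x with
  | nil => simp
  | cons a l ih =>
    intro φ ψ
    simp only [del_cons, ih, mul_add, Finset.sum_add_distrib]
    ring

lemma del_mul (x : List (Fin 3)) (r : ℝ) : ∀ φ : List (Fin 3) → ℝ,
    del y x (fun w => r * φ w) = r * del y x φ := by
  induction x with
  | nil => simp
  | cons a l ih =>
    intro φ
    simp only [del_cons, ih, mul_sub, Finset.mul_sum]
    congr 1
    exact Finset.sum_congr rfl fun b _ => Finset.sum_congr rfl fun c _ => by ring

lemma del_sub (x : List (Fin 3)) (φ ψ : List (Fin 3) → ℝ) :
    del y x (fun w => φ w - ψ w) = del y x φ - del y x ψ := by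
  have h := del_add y x φ fun w => (-1) * ψ w
  rw [del_mul] at h
  simpa [sub_eq_add_neg] using h

lemma del_zero (x : List (Fin 3)) : del y x (fun _ => 0) = 0 := by
  simpa using del_mul y x 0 fun _ => 0

lemma del_sum {ι : Type*} (s : Finset ι) (x : List (Fin 3)) (φ : ι → List (Fin 3) → ℝ) :
    del y x (fun w => ∑ i ∈ s, φ i w) = ∑ i ∈ s, del y x (φ i) := by
  classical
  induction s using Finset.induction_on with
  | empty => simp [del_zero]
  | insert i s hi ih => simp only [Finset.sum_insert hi, del_add, ih]

lemma ins_congr (x : List (Fin 3)) : ∀ {φ ψ : List (Fin 3) → ℝ},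
    (∀ w : List (Fin 3), w.length + 1 = x.length → φ w = ψ w) → ins y x φ = ins y x ψ := by
  induction x with
  | nil => simp
  | cons a l ih =>
    intro φ ψ h
    cases l with
    | nil => simp
    | cons b l =>
      rw [ins_cons_cons, ins_cons_cons, ih fun w hw => h (a :: w) (by simpa using hw)]
      congr 1
      exact Finset.sum_congr rfl fun c _ => by rw [h (c :: l) (by simp)]

lemma ins_add (x : List (Fin 3)) : ∀ φ ψ : List (Fin 3) → ℝ,
    ins y x (fun w => φ w + ψ w) = ins y x φ + ins y x ψ := by
  induction x with
  | nil => simp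
  | cons a l ih =>
    intro φ ψ
    cases l with
    | nil => simp
    | cons b l =>
      simp only [ins_cons_cons, ih, mul_add, Finset.sum_add_distrib]
      ring

lemma ins_mul (x : List (Fin 3)) (r : ℝ) : ∀ φ : List (Fin 3) → ℝ,
    ins y x (fun w => r * φ w) = r * ins y x φ := by
  induction x with
  | nil => simp
  | cons a l ih =>
    intro φ
    cases l with
    | nil => simp
    | cons b l =>
      simp only [ins_cons_cons, ih, mul_sub, Finset.mul_sum]
      congr 1
      exact Finset.sum_congr rfl fun c _ => by ring

lemma ins_sub (x : List (Fin 3)) (φ ψ : List (Fin 3) → ℝ) :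
    ins y x (fun w => φ w - ψ w) = ins y x φ - ins y x ψ := by
  have h := ins_add y x φ fun w => (-1) * ψ w
  rw [ins_mul] at h
  simpa [sub_eq_add_neg] using h

lemma ins_zero (x : List (Fin 3)) : ins y x (fun _ => 0) = 0 := by
  simpa using ins_mul y x 0 fun _ => 0

lemma ins_sum {ι : Type*} (s : Finset ι) (x : List (Fin 3)) (φ : ι → List (Fin 3) → ℝ) :
    ins y x (fun w => ∑ i ∈ s, φ i w) = ∑ i ∈ s, ins y x (φ i) := by
  classical
  induction s using Finset.induction_on with
  | empty => simp [ins_zero]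
  | insert i s hi ih => simp only [Finset.sum_insert hi, ins_add, ih]

lemma del_append_singleton (z : Fin 3) (x : List (Fin 3)) : ∀ φ : List (Fin 3) → ℝ,
    del y (x ++ [z]) φ = del y x (fun l => φ (l ++ [z]))
      + (-1) ^ x.length * ∑ b, ∑ c, charge y z b c * φ (x ++ [b, c]) := by
  induction x with
  | nil => intro φ; simp [del_cons]
  | cons a l ih =>
    intro φ
    simp only [List.cons_append, del_cons, ih, List.length_cons, pow_succ]
    ring

lemma ins_append_pair (b z : Fin 3) (x : List (Fin 3)) : ∀ φ : List (Fin 3) → ℝ,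
    ins y (x ++ [b, z]) φ = ins y (x ++ [b]) (fun l => φ (l ++ [z]))
      + (-1) ^ x.length * ∑ c, charge y c b z * φ (x ++ [c]) := by
  induction x with
  | nil => intro φ; simp [ins_cons_cons]
  | cons a l ih =>
    intro φ
    have key : ∀ (e : Fin 3) (m : List (Fin 3)), (e :: m : List (Fin 3)) = l ++ [b] →
        ins y (a :: (l ++ [b, z])) φ = (∑ c, charge y c a e * φ (c :: (m ++ [z])))
          - ins y (l ++ [b, z]) (fun w => φ (a :: w)) := by
      intro e m h
      have : l ++ [b, z] = e :: (m ++ [z]) := by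
        rw [← List.cons_append, h]; simp
      rw [this, ins_cons_cons]
    obtain ⟨e, m, h⟩ : ∃ e m, (e :: m : List (Fin 3)) = l ++ [b] := by
      cases l with
      | nil => exact ⟨b, [], rfl⟩
      | cons e l => exact ⟨e, l ++ [b], rfl⟩
    rw [List.cons_append, key e m h, ih, List.cons_append, ← h, ins_cons_cons]
    simp only [List.cons_append, List.length_cons, pow_succ]
    ring

end Linearity

section Supercharge

variable {y : ℝ}

lemma twist_mul_self (a : Fin 3) : twist a * twist a = 1 := by
  fin_cases a <;> simp [twist]

lemma charge_twist (y : ℝ) (a b c : Fin 3) :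
    charge y a b c * (twist b * twist c) = charge y a b c * twist a := by
  fin_cases a <;> fin_cases b <;> fin_cases c <;> simp [twist, charge]

lemma neg_one_pow_mul_self (n : ℕ) : (-1 : ℝ) ^ n * (-1) ^ n = 1 := by
  rw [← mul_pow]; simp

lemma TwistedCyclic.pair {φ : List (Fin 3) → ℝ} (h : TwistedCyclic φ) (b c : Fin 3)
    (l : List (Fin 3)) : φ (b :: c :: l) = twist b * twist c * φ (l ++ [b, c]) := by
  rw [h b (c :: l), List.cons_append, h c (l ++ [b])]
  simp only [List.length_cons, List.length_append, List.length_nil, List.append_assoc,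
    List.cons_append, List.nil_append]
  linear_combination (twist b * twist c * φ (l ++ [b, c])) *
    neg_one_pow_mul_self (l.length + 1)

lemma TwistedCyclic.cyclic_del {φ : List (Fin 3) → ℝ} (h : TwistedCyclic φ) :
    TwistedCyclic fun x => del y x φ := by
  intro a l
  simp only [del_cons, del_append_singleton]
  have h1 : del y l (fun m => φ (a :: m)) =
      (-1) ^ (l.length + 1) * twist a * del y l fun m => φ (m ++ [a]) := by
    rw [← del_mul]
    exact del_congr y l fun w hw => by rw [h a w, hw]
  have h2 : ∑ b, ∑ c, charge y a b c * φ (b :: c :: l) =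
      twist a * ∑ b, ∑ c, charge y a b c * φ (l ++ [b, c]) := by
    simp only [Finset.mul_sum]
    refine Finset.sum_congr rfl fun b _ => Finset.sum_congr rfl fun c _ => ?_
    rw [h.pair]
    linear_combination φ (l ++ [b, c]) * charge_twist y a b c
  rw [h1, h2, pow_succ]
  linear_combination (-(twist a * ∑ b, ∑ c, charge y a b c * φ (l ++ [b, c]))) *
    neg_one_pow_mul_self l.length

/-- The two-site vector measuring the failure of coassociativity of the supercharge. -/
def defect (y : ℝ) : Fin 3 → Fin 3 → ℝ :=
  ![![0, 0, y], ![0, y ^ 2, 0], ![y, 0, 0]]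

lemma charge_coassoc (y : ℝ) (a e f g : Fin 3) :
    ∑ b, (charge y a b g * charge y b e f - charge y a e b * charge y b f g) =
      defect y f g * (if e = a then 1 else 0) - defect y e f * (if g = a then 1 else 0) := by
  fin_cases a <;> fin_cases e <;> fin_cases f <;> fin_cases g <;>
    simp [charge, defect, Fin.sum_univ_three] <;> ring

end Supercharge

section Complex

variable {y : ℝ}

lemma sum_charge_assoc (y : ℝ) (a : Fin 3) (φ : Fin 3 → Fin 3 → Fin 3 → ℝ) :
    ∑ b, ∑ g, charge y a b g * (∑ e, ∑ f, charge y b e f * φ e f g)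
      - ∑ e, ∑ b, charge y a e b * (∑ f, ∑ g, charge y b f g * φ e f g) =
    ∑ f, ∑ g, defect y f g * φ a f g - ∑ e, ∑ f, defect y e f * φ e f a := by
  have h : ∑ e, ∑ f, ∑ g, (∑ b, (charge y a b g * charge y b e f
      - charge y a e b * charge y b f g)) * φ e f g =
      ∑ f, ∑ g, defect y f g * φ a f g - ∑ e, ∑ f, defect y e f * φ e f a := by
    simp only [charge_coassoc]
    simp only [sub_mul, Finset.sum_sub_distrib, mul_ite, mul_one, mul_zero, ite_mul, zero_mul]
    simp [Finset.sum_ite_eq']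
  rw [← h]
  simp only [Fin.sum_univ_three]
  ring

lemma del_del (x : List (Fin 3)) : ∀ φ : List (Fin 3) → ℝ,
    del y x (fun w => del y w φ) =
      ∑ b, ∑ c, defect y b c * (φ (x ++ [b, c]) - φ (b :: c :: x)) := by
  induction x with
  | nil => intro φ; simp
  | cons a l ih =>
    intro φ
    have h1 : ∑ b, ∑ c, charge y a b c * del y (b :: c :: l) φ =
        ∑ b, ∑ g, charge y a b g * (∑ e, ∑ f, charge y b e f * φ (e :: f :: g :: l))
        - ∑ e, ∑ b, charge y a e b * (∑ f, ∑ g, charge y b f g * φ (e :: f :: g :: l))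
        + ∑ b, ∑ c, charge y a b c * del y l fun m => φ (b :: c :: m) := by
      simp only [del_cons, ← Finset.sum_sub_distrib, ← Finset.sum_add_distrib]
      refine Finset.sum_congr rfl fun b _ => Finset.sum_congr rfl fun c _ => ?_
      ring
    have h2 : del y l (fun w => del y (a :: w) φ) =
        ∑ b, ∑ c, charge y a b c * (del y l fun m => φ (b :: c :: m))
        - del y l (fun w => del y w fun m => φ (a :: m)) := by
      simp only [del_cons, del_sub, del_sum, del_mul]
    rw [del_cons, h2, ih, h1, sum_charge_assoc y a fun e f g => φ (e :: f :: g :: l)]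
    simp only [mul_sub, Finset.sum_sub_distrib, List.cons_append]
    ring

lemma defect_twist (y : ℝ) (b c : Fin 3) :
    defect y b c * (twist b * twist c) = defect y b c := by
  fin_cases b <;> fin_cases c <;> simp [twist, defect]

lemma TwistedCyclic.del_del_eq_zero {φ : List (Fin 3) → ℝ} (h : TwistedCyclic φ)
    (x : List (Fin 3)) : del y x (fun w => del y w φ) = 0 := by
  rw [del_del]
  refine Finset.sum_eq_zero fun b _ => Finset.sum_eq_zero fun c _ => ?_
  rw [h.pair]
  linear_combination -φ (x ++ [b, c]) * defect_twist y b c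

/-- The contribution of the last and the first letter of a word to the supercharge of the
closed chain. -/
def wrap (y : ℝ) : List (Fin 3) → (List (Fin 3) → ℝ) → ℝ
  | [], _ => 0
  | [_], _ => 0
  | a :: b :: l, φ => (-1) ^ (l.length + 1) * twist ((b :: l).getLast (by simp)) *
      ∑ c, charge y c ((b :: l).getLast (by simp)) a * φ (c :: (b :: l).dropLast)

/-- The supercharge of the closed chain, evaluated at a word. -/
def closedIns (y : ℝ) (x : List (Fin 3)) (φ : List (Fin 3) → ℝ) : ℝ :=
  ins y x φ + wrap y x φ

lemma wrap_cons_append (y : ℝ) (a z : Fin 3) (m : List (Fin 3)) (φ : List (Fin 3) → ℝ) :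
    wrap y (a :: (m ++ [z])) φ =
      (-1) ^ (m.length + 1) * twist z * ∑ c, charge y c z a * φ (c :: m) := by
  obtain ⟨b, l, h⟩ : ∃ b l, m ++ [z] = b :: l := by
    cases m with
    | nil => exact ⟨z, [], rfl⟩
    | cons b l => exact ⟨b, l ++ [z], rfl⟩
  have hl : l.length = m.length := by simpa using (congrArg List.length h).symm
  have h1 : (b :: l).getLast (by simp) = z := by simp [← h]
  have h2 : (b :: l).dropLast = m := by simp [← h]
  rw [h, wrap, h1, h2, hl]

lemma TwistedCyclic.cyclic_closedIns {φ : List (Fin 3) → ℝ} (h : TwistedCyclic φ) :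
    TwistedCyclic fun x => closedIns y x φ := by
  intro a l
  rcases List.eq_nil_or_concat' l with rfl | ⟨m, z, rfl⟩
  · simp [closedIns, wrap]
  obtain ⟨e, l', he⟩ : ∃ e l', m ++ [z] = e :: l' := by
    cases m with
    | nil => exact ⟨z, [], rfl⟩
    | cons b l => exact ⟨b, l ++ [z], rfl⟩
  have hl : l'.length = m.length := by simpa using (congrArg List.length he).symm
  have h1 : ins y (a :: (m ++ [z])) φ = (∑ c, charge y c a e * φ (c :: l'))
      - (-1) ^ m.length * twist a * ins y (m ++ [z]) fun w => φ (w ++ [a]) := by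
    rw [he, ins_cons_cons, ← ins_mul]
    congr 1
    exact ins_congr y _ fun w hw => by
      rw [h a w, show w.length = m.length by simpa [hl] using hw]
  have h2 : wrap y (m ++ [z] ++ [a]) φ =
      (-1) ^ (m.length + 1) * twist a * ∑ c, charge y c a e * φ (c :: l') := by
    rw [he, List.cons_append, wrap_cons_append, hl]
  have h3 : twist z * ∑ c, charge y c z a * φ (c :: m) =
      (-1) ^ m.length * twist a * ∑ c, charge y c z a * φ (m ++ [c]) := by
    simp only [Finset.mul_sum]
    refine Finset.sum_congr rfl fun c _ => ?_
    rw [h c m]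
    linear_combination (-(-1) ^ m.length * φ (m ++ [c]) * twist z) * charge_twist y c z a
      + (-1) ^ m.length * φ (m ++ [c]) * charge y c z a * twist a * twist_mul_self z
  have h4 : ins y (m ++ [z] ++ [a]) φ = ins y (m ++ [z]) (fun w => φ (w ++ [a]))
      + (-1) ^ m.length * ∑ c, charge y c z a * φ (m ++ [c]) := by
    rw [← ins_append_pair]; simp
  simp only [closedIns]
  rw [h1, wrap_cons_append, h2, h4, List.length_append, List.length_singleton, pow_succ]
  linear_combination (-(-1) ^ m.length) * h3
    - (∑ c, charge y c a e * φ (c :: l')) * twist a * twist a *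
      neg_one_pow_mul_self m.length
    - (∑ c, charge y c a e * φ (c :: l')) * twist_mul_self a

end Complex

section WordSum

/-- The sum of a function over all words of a given length. -/
def wordSum : ℕ → (List (Fin 3) → ℝ) → ℝ
  | 0, φ => φ []
  | n + 1, φ => ∑ a, wordSum n fun l => φ (a :: l)

lemma wordSum_succ (n : ℕ) (φ : List (Fin 3) → ℝ) :
    wordSum (n + 1) φ = ∑ a, wordSum n fun l => φ (a :: l) := rfl

lemma wordSum_eq_sum_ofFn (n : ℕ) : ∀ φ : List (Fin 3) → ℝ,
    wordSum n φ = ∑ σ : Fin n → Fin 3, φ (List.ofFn σ) := by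
  induction n with
  | zero => intro φ; simp [wordSum]
  | succ n ih =>
    intro φ
    rw [wordSum_succ, ← (Fin.consEquiv fun _ => Fin 3).sum_comp, Fintype.sum_prod_type]
    refine Finset.sum_congr rfl fun a _ => ?_
    rw [ih]
    refine Finset.sum_congr rfl fun σ _ => ?_
    simp [Fin.consEquiv, List.ofFn_succ]

lemma wordSum_congr {n : ℕ} {φ ψ : List (Fin 3) → ℝ}
    (h : ∀ w : List (Fin 3), w.length = n → φ w = ψ w) : wordSum n φ = wordSum n ψ := by
  simp only [wordSum_eq_sum_ofFn]
  exact Finset.sum_congr rfl fun σ _ => h _ (by simp)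

lemma wordSum_add (n : ℕ) (φ ψ : List (Fin 3) → ℝ) :
    wordSum n (fun w => φ w + ψ w) = wordSum n φ + wordSum n ψ := by
  simp only [wordSum_eq_sum_ofFn, Finset.sum_add_distrib]

lemma wordSum_sub (n : ℕ) (φ ψ : List (Fin 3) → ℝ) :
    wordSum n (fun w => φ w - ψ w) = wordSum n φ - wordSum n ψ := by
  simp only [wordSum_eq_sum_ofFn, Finset.sum_sub_distrib]

lemma wordSum_sum {ι : Type*} (s : Finset ι) (n : ℕ) (φ : ι → List (Fin 3) → ℝ) :
    wordSum n (fun w => ∑ i ∈ s, φ i w) = ∑ i ∈ s, wordSum n (φ i) := by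
  simp only [wordSum_eq_sum_ofFn]
  exact Finset.sum_comm

lemma wordSum_append (k j : ℕ) : ∀ φ : List (Fin 3) → ℝ,
    wordSum (k + j) φ = wordSum k fun l => wordSum j fun s => φ (l ++ s) := by
  induction k with
  | zero => intro φ; simp [wordSum]
  | succ k ih =>
    intro φ
    rw [show k + 1 + j = k + j + 1 by omega]
    simp [wordSum_succ, ih]

lemma wordSum_succ_last (n : ℕ) (φ : List (Fin 3) → ℝ) :
    wordSum (n + 1) φ = ∑ a, wordSum n fun l => φ (l ++ [a]) := by
  rw [wordSum_append]
  simp only [wordSum, wordSum_sum]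

lemma eq_zero_of_wordSum_mul_self {n : ℕ} {φ : List (Fin 3) → ℝ}
    (h : wordSum n (fun w => φ w * φ w) = 0) {w : List (Fin 3)} (hw : w.length = n) :
    φ w = 0 := by
  subst hw
  rw [wordSum_eq_sum_ofFn, Finset.sum_eq_zero_iff_of_nonneg fun _ _ => mul_self_nonneg _] at h
  simpa using h w.get (Finset.mem_univ _)

lemma wordSum_mul_del (y : ℝ) (n : ℕ) : ∀ φ ψ : List (Fin 3) → ℝ,
    wordSum n (fun x => φ x * del y x ψ) = wordSum (n + 1) fun x => ins y x φ * ψ x := by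
  induction n with
  | zero => intro φ ψ; simp [wordSum]
  | succ n ih =>
    intro φ ψ
    have h1 : wordSum (n + 1 + 1) (fun x => ins y x φ * ψ x) =
        (∑ a, ∑ b, wordSum n fun l => (∑ c, charge y c a b * φ (c :: l)) * ψ (a :: b :: l))
        - ∑ a, wordSum (n + 1) fun x => ins y x (fun w => φ (a :: w)) * ψ (a :: x) := by
      simp only [wordSum_succ, ins_cons_cons, sub_mul, wordSum_sub, Finset.sum_sub_distrib]
    have h2 : wordSum (n + 1) (fun x => φ x * del y x ψ) =
        (∑ a, ∑ b, ∑ c, wordSum n fun l => charge y a b c * φ (a :: l) * ψ (b :: c :: l))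
        - ∑ a, wordSum n fun x => φ (a :: x) * del y x fun w => ψ (a :: w) := by
      simp only [wordSum_succ, del_cons, mul_sub, wordSum_sub, Finset.sum_sub_distrib,
        Finset.mul_sum, wordSum_sum]
      congr 1
      refine Finset.sum_congr rfl fun a _ => Finset.sum_congr rfl fun b _ =>
        Finset.sum_congr rfl fun c _ => wordSum_congr fun w _ => by ring
    rw [h1, h2]
    congr 1
    · simp only [Finset.sum_mul, wordSum_sum]
      rw [Finset.sum_comm]
      refine Finset.sum_congr rfl fun b _ => ?_
      rw [Finset.sum_comm]
    · exact Finset.sum_congr rfl fun a _ => ih _ _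

/-- The pairing of a function on words of length `n + 1` with the first term of the adjoint
supercharge. -/
def frontPairing (y : ℝ) (n : ℕ) (φ ψ : List (Fin 3) → ℝ) : ℝ :=
  wordSum n fun l => ∑ a, ∑ b, ∑ c, charge y a b c * φ (a :: l) * ψ (b :: c :: l)

lemma wordSum_mul_del_prefix (y : ℝ) {φ ψ : List (Fin 3) → ℝ} (hφ : TwistedCyclic φ)
    (hψ : TwistedCyclic ψ) (n k : ℕ) : ∀ j, k + j = n + 1 →
    wordSum k (fun l => wordSum j fun s => φ (l ++ s) * del y l fun w => ψ (w ++ s)) =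
      k * frontPairing y n φ ψ := by
  induction k with
  | zero => intro j _; simp [wordSum, wordSum_eq_sum_ofFn]
  | succ k ih =>
    intro j hj
    have h1 : frontPairing y n φ ψ = ∑ a, wordSum k fun l => wordSum j fun s =>
        φ (a :: (l ++ s)) * ∑ b, ∑ c, charge y a b c * ψ (b :: c :: (l ++ s)) := by
      rw [frontPairing, show n = k + j by omega, wordSum_append]
      simp only [← wordSum_sum]
      refine wordSum_congr fun l _ => wordSum_congr fun s _ => ?_
      refine Finset.sum_congr rfl fun a _ => ?_
      simp only [Finset.mul_sum]
      exact Finset.sum_congr rfl fun b _ => Finset.sum_congr rfl fun c _ => by ring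
    have h2 : k * frontPairing y n φ ψ = -∑ a, wordSum k fun l => wordSum j fun s =>
        φ (a :: (l ++ s)) * del y l fun w => ψ (a :: (w ++ s)) := by
      rw [← ih (j + 1) (by omega), ← Finset.sum_neg_distrib]
      simp only [wordSum_succ_last j]
      rw [wordSum_sum]
      refine Finset.sum_congr rfl fun a _ => ?_
      have neg : ∀ (m : ℕ) (θ : List (Fin 3) → ℝ), -wordSum m θ = wordSum m fun w => -θ w := by
        intro m θ; simp only [wordSum_eq_sum_ofFn, Finset.sum_neg_distrib]
      rw [neg]
      refine wordSum_congr fun l hl => ?_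
      rw [neg]
      refine wordSum_congr fun s hs => ?_
      have h3 : del y l (fun w => ψ (a :: (w ++ s))) =
          (-1) ^ (k + 1 + j) * twist a * del y l fun w => ψ (w ++ (s ++ [a])) := by
        rw [← del_mul]
        refine del_congr y l fun w hw => ?_
        rw [hψ, List.length_append, hw, hl, hs, List.append_assoc]
      rw [h3, hφ, List.length_append, hl, hs, List.append_assoc]
      have e : (-1 : ℝ) ^ (k + 1 + j) = -(-1) ^ (k + j) := by
        rw [show k + 1 + j = k + j + 1 by omega, pow_succ]; ring
      rw [e]
      set A := φ (l ++ (s ++ [a]))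
      set B := del y l fun w => ψ (w ++ (s ++ [a]))
      linear_combination (-A * B * twist a * twist a) * neg_one_pow_mul_self (k + j)
        - A * B * twist_mul_self a
    rw [wordSum_succ]
    simp only [List.cons_append, del_cons, mul_sub, wordSum_sub, Finset.sum_sub_distrib]
    rw [← h1]
    push_cast
    linear_combination -h2

lemma wordSum_wrap_mul (y : ℝ) {φ ψ : List (Fin 3) → ℝ} (hψ : TwistedCyclic ψ) (n : ℕ) :
    wordSum (n + 2) (fun x => wrap y x φ * ψ x) = frontPairing y n φ ψ := by
  rw [wordSum_succ]
  simp only [wordSum_succ_last n, frontPairing, wordSum_sum, wrap_cons_append]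
  have h : ∀ a z : Fin 3, wordSum n (fun l => (-1) ^ (l.length + 1) * twist z *
      (∑ c, charge y c z a * φ (c :: l)) * ψ (a :: (l ++ [z]))) =
      ∑ c, wordSum n fun l => charge y c z a * φ (c :: l) * ψ (z :: a :: l) := by
    intro a z
    rw [← wordSum_sum]
    refine wordSum_congr fun l _ => ?_
    simp only [← Finset.sum_mul]
    rw [hψ z (a :: l), List.length_cons, List.cons_append]
    ring
  simp only [h]
  rw [Finset.sum_comm]
  conv_rhs => rw [Finset.sum_comm]
  refine Finset.sum_congr rfl fun b _ => ?_
  rw [Finset.sum_comm]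

lemma TwistedCyclic.closedIns_eq_zero {y : ℝ} {φ : List (Fin 3) → ℝ} (hφ : TwistedCyclic φ)
    {n : ℕ} (h : wordSum (n + 1) (fun x => φ x * del y x fun w =>
      closedIns y w φ) = 0)
    {x : List (Fin 3)} (hx : x.length = n + 2) : closedIns y x φ = 0 := by
  have h1 := wordSum_mul_del_prefix y hφ (hφ.cyclic_closedIns (y := y)) n (n + 1) 0 rfl
  simp only [show ∀ θ, wordSum 0 θ = θ [] from fun _ => rfl, List.append_nil] at h1
  rw [h] at h1
  have h2 : frontPairing y n φ (fun w => closedIns y w φ) = 0 := by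
    have : ((n + 1 : ℕ) : ℝ) ≠ 0 := by positivity
    exact (mul_eq_zero.mp h1.symm).resolve_left this
  refine eq_zero_of_wordSum_mul_self (φ := fun w => closedIns y w φ) ?_ hx
  rw [wordSum_mul_del] at h
  have h3 := wordSum_wrap_mul y (φ := φ) (hφ.cyclic_closedIns (y := y)) n
  rw [h2] at h3
  have h4 : (fun w => closedIns y w φ * closedIns y w φ) =
      fun w => ins y w φ * closedIns y w φ + wrap y w φ * closedIns y w φ := by
    funext w; rw [← add_mul]; rfl
  rw [h4, wordSum_add, h, h3, add_zero]

end WordSum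

section LocalTerms

/-- The part of the two-site energy that arises from neighbouring applications of the
supercharge and its adjoint. -/
def hop (y : ℝ) (a b a' b' : Fin 3) : ℝ :=
  (∑ c, charge y c a b * charge y c a' b') - (∑ f, charge y a a' f * charge y b' f b)
    - ∑ e, charge y b e b' * charge y a' a e

/-- The diagonal one-site operator `(s³)²`. -/
def sqSpin : Fin 3 → ℝ := ![1, 0, 1]

/-- The matrix elements of the two-site energy. -/
def bond (y : ℝ) (a b a' b' : Fin 3) : ℝ :=
  hop y a b a' b' + if a = a' ∧ b = b' then
    2 + 3 * (y ^ 2 - 1) * sqSpin a - (y ^ 2 - 1) * sqSpin b else 0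

/-- The energy of the open chain. -/
def openEnergy (y : ℝ) : List (Fin 3) → (List (Fin 3) → ℝ) → ℝ
  | [], _ => 0
  | [_], _ => 0
  | a :: b :: l, φ => (∑ a', ∑ b', bond y a b a' b' * φ (a' :: b' :: l))
      + openEnergy y (b :: l) fun m => φ (a :: m)

lemma sum_bond (y : ℝ) (a b : Fin 3) (φ : Fin 3 → Fin 3 → ℝ) :
    ∑ a', ∑ b', bond y a b a' b' * φ a' b' = (∑ a', ∑ b', hop y a b a' b' * φ a' b') +
      (2 + 3 * (y ^ 2 - 1) * sqSpin a - (y ^ 2 - 1) * sqSpin b) * φ a b := by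
  simp only [bond, add_mul, Finset.sum_add_distrib, ite_and, ite_mul, zero_mul]
  simp

lemma sum_hop (y : ℝ) (a b : Fin 3) (φ : Fin 3 → Fin 3 → ℝ) :
    ∑ a', ∑ b', hop y a b a' b' * φ a' b' =
      (∑ c, charge y c a b * ∑ e, ∑ f, charge y c e f * φ e f)
      - (∑ e, ∑ f, charge y a e f * ∑ c, charge y c f b * φ e c)
      - ∑ e, ∑ f, charge y b e f * ∑ c, charge y c a e * φ c f := by
  simp only [hop, Fin.sum_univ_three]
  ring

lemma sum_charge_mul_charge (y : ℝ) (a : Fin 3) (φ : Fin 3 → ℝ) :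
    ∑ b, ∑ c, charge y a b c * ∑ e, charge y e b c * φ e =
      (2 + 2 * (y ^ 2 - 1) * sqSpin a) * φ a := by
  fin_cases a <;> simp [charge, sqSpin, Fin.sum_univ_three] <;> ring

/-- The first term of the supercharge, for a word with first letter `a`. -/
def insFront (y : ℝ) (a : Fin 3) (φ : List (Fin 3) → ℝ) : List (Fin 3) → ℝ
  | [] => 0
  | b :: l => ∑ c, charge y c a b * φ (c :: l)

lemma ins_cons (y : ℝ) (a : Fin 3) (x : List (Fin 3)) (φ : List (Fin 3) → ℝ) :
    ins y (a :: x) φ = insFront y a φ x - ins y x fun m => φ (a :: m) := by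
  cases x <;> simp [insFront, ins_cons_cons]

/-- The anticommutator of the open supercharge and its adjoint is the open energy, up to
one-site terms at the ends of the chain. -/
lemma del_ins_add_ins_del (y : ℝ) (l : List (Fin 3)) : ∀ (a : Fin 3) (φ : List (Fin 3) → ℝ),
    del y (a :: l) (fun w => ins y w φ) + ins y (a :: l) (fun w => del y w φ) =
      openEnergy y (a :: l) φ + (2 - (y ^ 2 - 1) * sqSpin a
        + 3 * (y ^ 2 - 1) * sqSpin ((a :: l).getLast (by simp))) * φ (a :: l) := by
  induction l with
  | nil =>
    intro a φ
    have h := sum_charge_mul_charge y a fun e => φ [e]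
    simp only [del_cons, del_nil, ins_cons_cons, ins_singleton, openEnergy, List.getLast_singleton,
      sub_zero]
    linear_combination h
  | cons b l ih =>
    intro a φ
    have h1 : del y (a :: b :: l) (fun w => ins y w φ) =
        (∑ e, ∑ f, charge y a e f * ∑ c, charge y c e f * φ (c :: b :: l))
        - (∑ e, ∑ f, charge y a e f * ∑ c, charge y c f b * φ (e :: c :: l))
        + (∑ e, ∑ f, charge y a e f * ins y (b :: l) fun m => φ (e :: f :: m))
        - (∑ e, ∑ f, charge y b e f * ∑ c, charge y c a e * φ (c :: f :: l))
        + (∑ c, charge y c a b * del y l fun m => φ (c :: m))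
        + del y (b :: l) fun w => ins y w fun m => φ (a :: m) := by
      rw [del_cons]
      simp only [ins_cons y a, del_sub]
      rw [del_cons y b l (insFront y a φ)]
      simp only [insFront, ins_cons_cons, del_sum, del_mul, mul_sub, Finset.sum_sub_distrib]
      ring
    have h2 : ins y (a :: b :: l) (fun w => del y w φ) =
        (∑ c, charge y c a b * ∑ e, ∑ f, charge y c e f * φ (e :: f :: l))
        - (∑ c, charge y c a b * del y l fun m => φ (c :: m))
        - (∑ e, ∑ f, charge y a e f * ins y (b :: l) fun m => φ (e :: f :: m))
        + ins y (b :: l) fun w => del y w fun m => φ (a :: m) := by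
      rw [ins_cons_cons]
      simp only [del_cons, ins_sub, ins_sum, ins_mul, mul_sub, Finset.sum_sub_distrib]
      ring
    have h3 := ih b fun m => φ (a :: m)
    have h4 := sum_hop y a b fun e f => φ (e :: f :: l)
    have h5 := sum_charge_mul_charge y a fun e => φ (e :: b :: l)
    rw [h1, h2, openEnergy, sum_bond y a b fun e f => φ (e :: f :: l), List.getLast_cons_cons]
    linear_combination h3 - h4 + h5

lemma hop_twist (y : ℝ) (a b a' b' : Fin 3) :
    hop y a b a' b' * (twist b * twist b') = hop y a b a' b' * (twist a * twist a') := by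
  fin_cases a <;> fin_cases b <;> fin_cases a' <;> fin_cases b' <;>
    simp [twist, hop, charge, Fin.sum_univ_three]

/-- The energy of the bond that closes the chain, between the last and the first site. -/
lemma TwistedCyclic.del_wrap {y : ℝ} {φ : List (Fin 3) → ℝ} (hφ : TwistedCyclic φ)
    (hd : ∀ x, del y x φ = 0) (a z : Fin 3) (m : List (Fin 3)) :
    del y (a :: (m ++ [z])) (fun w => wrap y w φ) =
      ∑ z', ∑ a', hop y z a z' a' * (twist a * twist a') * φ (a' :: (m ++ [z'])) := by
  have h1 : ∑ b, ∑ c, charge y a b c * wrap y (b :: c :: (m ++ [z])) φ =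
      (-1) ^ m.length * twist z *
        ∑ b, ∑ c, charge y a b c * ∑ e, charge y e z b * φ (e :: c :: m) := by
    rw [Finset.mul_sum]
    refine Finset.sum_congr rfl fun b _ => ?_
    rw [Finset.mul_sum]
    refine Finset.sum_congr rfl fun c _ => ?_
    rw [← List.cons_append, wrap_cons_append, List.length_cons, pow_succ, pow_succ]
    ring
  have h2 : del y m (fun w => wrap y (a :: (w ++ [z])) φ) =
      (-1) ^ m.length * twist z *
        ∑ c, charge y c z a * ∑ e, ∑ f, charge y c e f * φ (e :: f :: m) := by
    have h : ∀ c, del y m (fun w => φ (c :: w)) =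
        ∑ e, ∑ f, charge y c e f * φ (e :: f :: m) := by
      intro c
      have := hd (c :: m)
      rw [del_cons] at this
      linear_combination -this
    simp only [← h, ← del_mul, ← del_sum]
    refine del_congr y m fun w hw => ?_
    rw [wrap_cons_append, hw, pow_succ, pow_succ]
    ring
  have h3 : ∑ b, ∑ c, charge y z b c * wrap y (a :: (m ++ [b, c])) φ =
      -twist z * ∑ b, ∑ c, charge y z b c * ∑ e, charge y e c a * φ (b :: e :: m) := by
    rw [Finset.mul_sum]
    refine Finset.sum_congr rfl fun b _ => ?_
    rw [Finset.mul_sum]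
    refine Finset.sum_congr rfl fun c _ => ?_
    have h : ∑ e, charge y e c a * φ (b :: e :: m) =
        (-1) ^ (m.length + 1) * twist b * ∑ e, charge y e c a * φ (e :: (m ++ [b])) := by
      rw [Finset.mul_sum]
      refine Finset.sum_congr rfl fun e _ => ?_
      rw [hφ b]
      simp only [List.length_cons, List.cons_append]
      ring
    rw [h, show m ++ [b, c] = (m ++ [b]) ++ [c] by simp, wrap_cons_append, List.length_append,
      List.length_singleton]
    set S := ∑ e, charge y e c a * φ (e :: (m ++ [b]))
    rw [pow_succ]
    linear_combination (-(-1) ^ (m.length + 1) * S * twist b) * charge_twist y z b c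
      + (-1) ^ (m.length + 1) * S * charge y z b c * twist c * twist_mul_self b
  have h4 : ∑ z', ∑ a', hop y z a z' a' * (twist a * twist a') * φ (a' :: (m ++ [z'])) =
      (-1) ^ (m.length + 1) * twist z *
        ∑ z', ∑ a', hop y z a z' a' * φ (z' :: a' :: m) := by
    rw [Finset.mul_sum]
    refine Finset.sum_congr rfl fun z' _ => ?_
    rw [Finset.mul_sum]
    refine Finset.sum_congr rfl fun a' _ => ?_
    rw [hφ z']
    simp only [List.length_cons, List.cons_append]
    linear_combination φ (a' :: (m ++ [z'])) * hop_twist y z a z' a'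
      - φ (a' :: (m ++ [z'])) * hop y z a z' a' * twist z * twist z' *
        neg_one_pow_mul_self (m.length + 1)
  rw [del_cons, h1, del_append_singleton]
  simp only [h2, h3, h4]
  rw [sum_hop y z a fun e f => φ (e :: f :: m), pow_succ]
  ring

end LocalTerms

section ZeroEnergy

variable {y : ℝ} {φ : List (Fin 3) → ℝ}

/-- A twisted cyclic function annihilated by the supercharge and its adjoint has vanishing
energy on the closed chain. -/
lemma TwistedCyclic.openEnergy_add_eq_zero (hφ : TwistedCyclic φ) (hd : ∀ x, del y x φ = 0)
    (a z : Fin 3) (m : List (Fin 3))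
    (hc : ∀ x : List (Fin 3), x.length = m.length + 3 → closedIns y x φ = 0) :
    openEnergy y (a :: (m ++ [z])) φ +
      ∑ z', ∑ a', bond y z a z' a' * (twist a * twist a') * φ (a' :: (m ++ [z'])) = 0 := by
  have h1 := del_ins_add_ins_del y (m ++ [z]) a φ
  simp only [hd, ins_zero, add_zero] at h1
  have h2 : del y (a :: (m ++ [z])) (fun w => ins y w φ) =
      -del y (a :: (m ++ [z])) fun w => wrap y w φ := by
    rw [← neg_one_mul, ← del_mul]
    refine del_congr y _ fun w hw => ?_
    have h := hc w (by simpa using hw)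
    rw [closedIns] at h
    linear_combination h
  have h3 : ∑ z', ∑ a', bond y z a z' a' * (twist a * twist a') * φ (a' :: (m ++ [z'])) =
      (∑ z', ∑ a', hop y z a z' a' * (twist a * twist a') * φ (a' :: (m ++ [z']))) +
      (2 + 3 * (y ^ 2 - 1) * sqSpin z - (y ^ 2 - 1) * sqSpin a) * φ (a :: (m ++ [z])) := by
    simp only [bond, add_mul, Finset.sum_add_distrib, ite_and, ite_mul, zero_mul]
    simp only [Finset.sum_ite_irrel, Finset.sum_const_zero, Finset.sum_ite_eq, Finset.mem_univ,
      if_true, twist_mul_self, mul_one]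
  have h4 : (a :: (m ++ [z])).getLast (by simp) = z := by simp
  rw [h2, h4, hφ.del_wrap hd] at h1
  linear_combination h3 - h1

end ZeroEnergy

section Contraction

/-- The contraction of the first two letters with the two-site vector
`(1 - t) ⇑⇓ + t ⇓⇑ + 2 y t (1 - t) 00`. -/
def con (y t : ℝ) (φ : List (Fin 3) → ℝ) (l : List (Fin 3)) : ℝ :=
  (1 - t) * φ (0 :: 2 :: l) + t * φ (2 :: 0 :: l) + 2 * y * t * (1 - t) * φ (1 :: 1 :: l)

/-- The analogue of `con` for the last two letters. -/
def conLast (y t : ℝ) (φ : List (Fin 3) → ℝ) (l : List (Fin 3)) : ℝ :=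
  (1 - t) * φ (l ++ [0, 2]) + t * φ (l ++ [2, 0]) + 2 * y * t * (1 - t) * φ (l ++ [1, 1])

/-- The derivative of `con` with respect to the parameter `t`. -/
def conDeriv (y t : ℝ) (φ : List (Fin 3) → ℝ) (l : List (Fin 3)) : ℝ :=
  -φ (0 :: 2 :: l) + φ (2 :: 0 :: l) + 2 * y * (1 - 2 * t) * φ (1 :: 1 :: l)

variable (y t : ℝ)

lemma con_del (φ : List (Fin 3) → ℝ) : con y t (fun w => del y w φ) = fun l =>
    del y l (con y t φ) + y * (1 - 2 * t) *
      (con y t (fun w => φ (1 :: w)) l - con y t φ (1 :: l)) := by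
  funext l
  have h : del y l (con y t φ) = (1 - t) * del y l (fun w => φ (0 :: 2 :: w))
      + t * del y l (fun w => φ (2 :: 0 :: w))
      + 2 * y * t * (1 - t) * del y l (fun w => φ (1 :: 1 :: w)) := by
    simp only [← del_mul, ← del_add]
    rfl
  rw [h]
  simp [con, del_cons, charge, Fin.sum_univ_three]
  ring

lemma con_iterate_add (k : ℕ) : ∀ φ ψ : List (Fin 3) → ℝ,
    (con y t)^[k] (fun w => φ w + ψ w) = fun w => (con y t)^[k] φ w + (con y t)^[k] ψ w := by
  induction k with
  | zero => intro φ ψ; rfl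
  | succ k ih =>
    intro φ ψ
    simp only [Function.iterate_succ_apply]
    rw [← ih]
    congr 1
    funext w
    simp only [con]
    ring

lemma con_iterate_mul (k : ℕ) (r : ℝ) : ∀ φ : List (Fin 3) → ℝ,
    (con y t)^[k] (fun w => r * φ w) = fun w => r * (con y t)^[k] φ w := by
  induction k with
  | zero => intro φ; rfl
  | succ k ih =>
    intro φ
    simp only [Function.iterate_succ_apply]
    rw [← ih]
    congr 1
    funext w
    simp only [con]
    ring

lemma con_iterate_congr (k : ℕ) : ∀ {φ ψ : List (Fin 3) → ℝ} (l : List (Fin 3)),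
    (∀ w : List (Fin 3), w.length = l.length + 2 * k → φ w = ψ w) →
    (con y t)^[k] φ l = (con y t)^[k] ψ l := by
  induction k with
  | zero => intro φ ψ l h; exact h l (by simp)
  | succ k ih =>
    intro φ ψ l h
    simp only [Function.iterate_succ_apply]
    refine ih l fun w hw => ?_
    have e : ∀ a b : Fin 3, φ (a :: b :: w) = ψ (a :: b :: w) := fun a b =>
      h _ (by simp only [List.length_cons]; omega)
    simp only [con, e]

lemma con_iterate_append (k : ℕ) (s : List (Fin 3)) : ∀ φ : List (Fin 3) → ℝ,
    (con y t)^[k] φ s = (con y t)^[k] (fun w => φ (w ++ s)) [] := by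
  induction k with
  | zero => intro φ; rfl
  | succ k ih =>
    intro φ
    simp only [Function.iterate_succ_apply]
    rw [ih]
    rfl

lemma con_iterate_del (k : ℕ) : ∀ φ : List (Fin 3) → ℝ,
    (con y t)^[k] (fun w => del y w φ) = fun l => del y l ((con y t)^[k] φ) +
      y * (1 - 2 * t) * ((con y t)^[k] (fun w => φ (1 :: w)) l
        - (con y t)^[k] φ (1 :: l)) := by
  induction k with
  | zero => intro φ; funext l; simp
  | succ k ih =>
    intro φ
    have h : con y t (fun w => del y w φ) = fun l => del y l (con y t φ) +
        (y * (1 - 2 * t) * con y t (fun w => φ (1 :: w)) l +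
          -(y * (1 - 2 * t)) * con y t φ (1 :: l)) := by
      rw [con_del]
      funext l
      ring
    simp only [Function.iterate_succ_apply]
    rw [h, con_iterate_add, con_iterate_add, con_iterate_mul, con_iterate_mul, ih]
    funext l
    ring

lemma con_conLast (φ : List (Fin 3) → ℝ) :
    con y t (conLast y t φ) = conLast y t (con y t φ) := by
  funext l
  simp only [con, conLast, List.cons_append]
  ring

lemma conDeriv_conLast (φ : List (Fin 3) → ℝ) :
    conDeriv y t (conLast y t φ) = conLast y t (conDeriv y t φ) := by
  funext l
  simp only [conDeriv, conLast, List.cons_append]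
  ring

lemma conLast_iterate_nil (k : ℕ) : ∀ φ : List (Fin 3) → ℝ,
    (conLast y t)^[k] φ [] = (con y t)^[k] φ [] := by
  have hc : Function.Commute (con y t) (conLast y t) := con_conLast y t
  induction k with
  | zero => intro φ; rfl
  | succ k ih =>
    intro φ
    rw [Function.iterate_succ_apply, ih, hc.iterate_left k φ, Function.iterate_succ_apply']
    rfl

variable {y t} {φ : List (Fin 3) → ℝ}

lemma TwistedCyclic.conLast_eq (hφ : TwistedCyclic φ) : conLast y t φ = con y t φ := by
  funext l
  simp [con, conLast, hφ.pair, twist]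

lemma TwistedCyclic.con_iterate_eq (hφ : TwistedCyclic φ) (k : ℕ) :
    (con y t)^[k] φ = (conLast y t)^[k] φ := by
  have hc : Function.Commute (con y t) (conLast y t) := con_conLast y t
  induction k with
  | zero => rfl
  | succ k ih =>
    rw [Function.iterate_succ_apply', ih, hc.iterate_right k φ, Function.iterate_succ_apply,
      hφ.conLast_eq]

lemma TwistedCyclic.con_iterate_conDeriv (hφ : TwistedCyclic φ) (i j : ℕ) :
    (con y t)^[i] (conDeriv y t ((con y t)^[j] φ)) [] =
      (con y t)^[i + j] (conDeriv y t φ) [] := by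
  have hc : Function.Commute (con y t) (conLast y t) := con_conLast y t
  have hd : Function.Commute (conDeriv y t) (conLast y t) := conDeriv_conLast y t
  rw [hφ.con_iterate_eq, hd.iterate_right j φ, (hc.iterate_left i).iterate_right j,
    conLast_iterate_nil, ← Function.iterate_add_apply, add_comm]

/-- The derivative of the iterated contraction with respect to `t`. -/
def conIterDeriv (y t : ℝ) : ℕ → (List (Fin 3) → ℝ) → List (Fin 3) → ℝ
  | 0, _ => fun _ => 0
  | k + 1, φ => fun l => conDeriv y t ((con y t)^[k] φ) l + con y t (conIterDeriv y t k φ) l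

lemma hasDerivAt_con_iterate (y t : ℝ) (φ : List (Fin 3) → ℝ) (k : ℕ) : ∀ l,
    HasDerivAt (fun t => (con y t)^[k] φ l) (conIterDeriv y t k φ l) t := by
  induction k with
  | zero => intro l; exact hasDerivAt_const _ _
  | succ k ih =>
    intro l
    simp only [Function.iterate_succ_apply', con]
    have ht := hasDerivAt_id' t
    have hs := ht.const_sub 1
    refine (((hs.mul (ih (0 :: 2 :: l))).add (ht.mul (ih (2 :: 0 :: l)))).add
      (((ht.const_mul (2 * y)).mul hs).mul (ih (1 :: 1 :: l)))).congr_deriv ?_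
    simp only [conIterDeriv, conDeriv, con, Pi.mul_apply]
    ring

lemma TwistedCyclic.con_iterate_conIterDeriv (hφ : TwistedCyclic φ) (k : ℕ) : ∀ j,
    (con y t)^[j] (conIterDeriv y t (k + 1) φ) [] =
      (k + 1) * (con y t)^[k + j] (conDeriv y t φ) [] := by
  induction k with
  | zero =>
    intro j
    have h : conIterDeriv y t (0 + 1) φ = conDeriv y t φ := by
      funext l
      simp [conIterDeriv, con]
    simp [h]
  | succ k ih =>
    intro j
    have h := ih (j + 1)
    rw [Function.iterate_succ_apply] at h
    rw [conIterDeriv, con_iterate_add]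
    beta_reduce
    rw [hφ.con_iterate_conDeriv, h, show k + (j + 1) = k + 1 + j by omega, add_comm j]
    push_cast
    ring

lemma con_zero_iterate_cons (y : ℝ) (k : ℕ) (l : List (Fin 3)) : ∀ φ : List (Fin 3) → ℝ,
    (con y 0)^[k] φ (0 :: l) = (con y 1)^[k] (fun w => φ (0 :: w)) l := by
  induction k with
  | zero => intro φ; rfl
  | succ k ih =>
    intro φ
    simp only [Function.iterate_succ_apply]
    rw [ih]
    have h : (fun w => con y 0 φ (0 :: w)) = con y 1 fun w => φ (0 :: w) := by
      funext w
      simp [con]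
    rw [h]

lemma TwistedCyclic.con_zero_iterate_eq (hφ : TwistedCyclic φ) (k : ℕ) :
    (con y 0)^[k + 1] φ [] = (con y 1)^[k + 1] φ [] := by
  have h : (con y 0)^[k + 1] φ [] = (con y 0)^[k] φ [0, 2] := by
    rw [Function.iterate_succ_apply']
    simp [con]
  rw [h, con_zero_iterate_cons, con_iterate_append, Function.iterate_succ_apply]
  refine con_iterate_congr y 1 k [] fun w hw => ?_
  have hw' : w.length = 2 * k := by simpa using hw
  have e := hφ.pair 2 0 w
  rw [hφ 0 (w ++ [2])]
  simp [con, e, twist, hw', pow_succ, pow_mul]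

/-- The function that singles out the word of `N` letters `0`. -/
def zeroWord (N : ℕ) (w : List (Fin 3)) : ℝ := if w = List.replicate N 1 then 1 else 0

/-- The function that singles out the words of length `N` without the letter `0` and with
equally many letters `⇑` and `⇓`. -/
def alternating (N : ℕ) (w : List (Fin 3)) : ℝ :=
  if w.length = N ∧ 1 ∉ w ∧ w.count 0 = w.count 2 then 1 else 0

lemma con_iterate_zeroWord (y t : ℝ) (n : ℕ) :
    (con y t)^[n] (fun w => zeroWord (2 * n + 1) (1 :: w)) [] = (2 * y * t * (1 - t)) ^ n := by
  induction n with
  | zero => simp [zeroWord]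
  | succ n ih =>
    rw [Function.iterate_succ_apply]
    have h : con y t (fun w => zeroWord (2 * (n + 1) + 1) (1 :: w)) =
        fun w => (2 * y * t * (1 - t)) * zeroWord (2 * n + 1) (1 :: w) := by
      funext w
      simp [con, zeroWord, show 2 * (n + 1) + 1 = 2 * n + 1 + 1 + 1 by ring,
        List.replicate_succ]
    rw [h, con_iterate_mul]
    beta_reduce
    rw [ih, pow_succ]
    ring

lemma TwistedCyclic.con_iterate_conDeriv_nil (hφ : TwistedCyclic φ) (n : ℕ)
    (h : ∀ x : List (Fin 3), x.length = 2 * n + 1 → del y x φ = zeroWord (2 * n + 1) x) :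
    (con y t)^[n] (conDeriv y t φ) [] = -(2 * y * t * (1 - t)) ^ n := by
  have h1 : conDeriv y t φ = fun l => (-1) * del y (1 :: l) φ +
      ((-1) * del y l (fun w => φ (1 :: w)) +
        2 * y * (1 - 2 * t) * φ (1 :: 1 :: l)) := by
    funext l
    simp [conDeriv, del_cons, charge, Fin.sum_univ_three]
    ring
  have h2 : (con y t)^[n] (fun l => del y (1 :: l) φ) [] = (2 * y * t * (1 - t)) ^ n := by
    rw [← con_iterate_zeroWord]
    exact con_iterate_congr y t n [] fun w hw => h _ (by simpa using hw)
  have h3 : (con y t)^[n] (fun w => φ (1 :: w)) [1] =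
      -(con y t)^[n] (fun w => φ (1 :: 1 :: w)) [] := by
    have e := con_iterate_mul y t n (-1) fun w => φ (1 :: 1 :: w)
    rw [con_iterate_append, ← neg_one_mul, ← congrFun e []]
    refine con_iterate_congr y t n [] fun w hw => ?_
    have hw' : w.length = 2 * n := by simpa using hw
    have e := hφ.pair 1 1 w
    rw [hφ 1 (w ++ [1])]
    simp [e, twist, hw', pow_succ, pow_mul]
  rw [h1, con_iterate_add, con_iterate_add, con_iterate_mul, con_iterate_mul, con_iterate_mul,
    con_iterate_del]
  simp only [h2, h3, del_nil]
  ring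

/-- For an odd number of sites, the word of letters `0` is not in the image of the adjoint
supercharge. -/
lemma TwistedCyclic.exists_del_ne_zeroWord (hy : y ≠ 0) (hφ : TwistedCyclic φ) (n : ℕ) :
    ∃ x : List (Fin 3), x.length = 2 * n + 1 ∧ del y x φ ≠ zeroWord (2 * n + 1) x := by
  by_contra! h
  obtain ⟨t, ht, h0⟩ := exists_hasDerivAt_eq_zero (f := fun t => (con y t)^[n + 1] φ [])
    (f' := fun t => conIterDeriv y t (n + 1) φ []) zero_lt_one
    (fun t _ => (hasDerivAt_con_iterate y t φ (n + 1) []).continuousAt.continuousWithinAt)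
    (hφ.con_zero_iterate_eq n) fun t _ => hasDerivAt_con_iterate y t φ (n + 1) []
  have h1 := hφ.con_iterate_conIterDeriv (y := y) (t := t) n 0
  rw [Function.iterate_zero_apply, h0, add_zero, hφ.con_iterate_conDeriv_nil n h] at h1
  have h2 : (2 * y * t * (1 - t)) ^ n ≠ 0 := by
    have := ht.1.ne'
    have := (sub_pos.mpr ht.2).ne'
    positivity
  have h3 : (n : ℝ) + 1 ≠ 0 := by positivity
  exact mul_ne_zero h3 (neg_ne_zero.mpr h2) h1.symm

lemma con_alternating (y : ℝ) (k : ℕ) : con y (1 / 2) (alternating (k + 2)) = alternating k := by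
  funext w
  have h : (alternating (k + 2) (0 :: 2 :: w) = alternating k w) ∧
      (alternating (k + 2) (2 :: 0 :: w) = alternating k w) := by
    simp [alternating]
  have h1 : alternating (k + 2) (1 :: 1 :: w) = 0 := by simp [alternating]
  simp only [con, h, h1]
  ring

lemma con_iterate_alternating (y : ℝ) (m : ℕ) :
    (con y (1 / 2))^[m] (alternating (2 * m)) [] = 1 := by
  induction m with
  | zero => simp [alternating]
  | succ m ih => rw [Function.iterate_succ_apply, mul_add, mul_one, con_alternating, ih]

/-- For an even number of sites, the sum of the words without letter `0` and of vanishing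
magnetisation is not in the image of the adjoint supercharge. -/
lemma exists_del_ne_alternating (y : ℝ) (φ : List (Fin 3) → ℝ) (m : ℕ) :
    ∃ x : List (Fin 3), x.length = 2 * m ∧ del y x φ ≠ alternating (2 * m) x := by
  by_contra! h
  have h1 := con_iterate_alternating y m
  have h2 := congrFun (con_iterate_del y (1 / 2) m φ) []
  rw [← con_iterate_congr y (1 / 2) m (φ := fun w => del y w φ) []
    fun w hw => h w (by simpa using hw), h2] at h1
  norm_num at h1

/-- A function on words is annihilated by the adjoint supercharge if it is supported on words
that do not contain the letter `0` next to a different letter, and if it is invariant under the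
exchange of neighbouring letters `⇑` and `⇓`. -/
lemma del_eq_zero_of_support (y : ℝ) (x : List (Fin 3)) : ∀ {φ : List (Fin 3) → ℝ},
    (∀ p b c s, φ (p ++ b :: c :: s) ≠ 0 → (b = 1 ↔ c = 1)) →
    (∀ p s, φ (p ++ 0 :: 2 :: s) = φ (p ++ 2 :: 0 :: s)) → del y x φ = 0 := by
  induction x with
  | nil => simp
  | cons a l ih =>
    intro φ h hs
    have h0 : ∀ b c, ¬(b = 1 ↔ c = 1) → φ (b :: c :: l) = 0 := fun b c hbc => by
      by_contra h1
      exact hbc (h [] b c l h1)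
    have h1 := hs [] l
    simp only [List.nil_append] at h1
    rw [del_cons, ih (fun p b c s => h (a :: p) b c s) fun p s => hs (a :: p) s, sub_zero]
    fin_cases a <;> simp [charge, Fin.sum_univ_three, h0, h1]

lemma del_zeroWord (y : ℝ) (N : ℕ) (x : List (Fin 3)) : del y x (zeroWord N) = 0 := by
  have key : ∀ w a, zeroWord N w ≠ 0 → a ∈ w → a = 1 := fun w a h ha => by
    have h' : w = List.replicate N 1 := by
      by_contra h'
      exact h (if_neg h')
    exact List.eq_of_mem_replicate (h' ▸ ha)
  refine del_eq_zero_of_support y x (fun p b c s h => ?_) fun p s => ?_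
  · simp [key _ b h (by simp), key _ c h (by simp)]
  · have h : ∀ w, (0 : Fin 3) ∈ w → zeroWord N w = 0 := fun w hw => by
      by_contra h
      exact absurd (key w 0 h hw) (by simp)
    rw [h _ (by simp), h _ (by simp)]

lemma alternating_perm (N : ℕ) {l m : List (Fin 3)} (h : l.Perm m) :
    alternating N l = alternating N m := by
  simp only [alternating, h.length_eq, h.mem_iff, h.count_eq]

lemma del_alternating (y : ℝ) (N : ℕ) (x : List (Fin 3)) : del y x (alternating N) = 0 := by
  refine del_eq_zero_of_support y x (fun p b c s h => ?_) fun p s =>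
    alternating_perm N ((List.Perm.swap 2 0 s).append_left p)
  have h' : (1 : Fin 3) ∉ p ++ b :: c :: s := by
    by_contra h'
    exact h (if_neg fun h => h.2.1 h')
  simp only [List.mem_append, List.mem_cons, not_or] at h'
  exact iff_of_false (Ne.symm h'.2.1) (Ne.symm h'.2.2.1)

lemma twistedCyclic_zeroWord (n : ℕ) : TwistedCyclic (zeroWord (2 * n + 1)) := by
  intro a l
  have h : (a :: l = List.replicate (2 * n + 1) 1) ↔ l ++ [a] = List.replicate (2 * n + 1) 1 := by
    rw [List.eq_replicate_iff, List.eq_replicate_iff]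
    simp [and_comm, or_imp, forall_and]
  by_cases h1 : a :: l = List.replicate (2 * n + 1) 1
  · rw [zeroWord, zeroWord, if_pos h1, if_pos (h.mp h1)]
    rw [List.replicate_succ, List.cons_eq_cons] at h1
    simp [h1.1, h1.2, twist, pow_mul]
  · rw [zeroWord, zeroWord, if_neg h1, if_neg fun h2 => h1 (h.mpr h2), mul_zero]

lemma twistedCyclic_alternating (m : ℕ) : TwistedCyclic (alternating (2 * m)) := by
  intro a l
  rw [alternating_perm (2 * m) (List.perm_append_singleton a l)]
  by_cases h : (a :: l).length = 2 * m ∧ 1 ∉ a :: l ∧ (a :: l).count 0 = (a :: l).count 2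
  · have hl : Odd l.length := ⟨m - 1, by have := h.1; rw [List.length_cons] at this; omega⟩
    have ha : a ≠ 1 := fun ha => h.2.1 (by simp [ha])
    rw [hl.neg_one_pow]
    revert ha
    fin_cases a <;> simp [twist]
  · rw [alternating, if_neg h, mul_zero]

end Contraction

section Magnetisation

/-- The eigenvalues of `s³`. -/
def spin : Fin 3 → ℤ := ![1, 0, -1]

/-- The magnetisation of a word. -/
def mag (l : List (Fin 3)) : ℤ := (l.map spin).sum

lemma mag_nil : mag [] = 0 := rfl

lemma mag_cons (a : Fin 3) (l : List (Fin 3)) : mag (a :: l) = spin a + mag l := by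
  simp [mag]

lemma mag_append (l m : List (Fin 3)) : mag (l ++ m) = mag l + mag m := by
  simp [mag]

lemma mag_eq_count_sub (l : List (Fin 3)) : mag l = l.count 0 - l.count 2 := by
  induction l with
  | nil => simp [mag]
  | cons a l ih =>
    rw [mag_cons, ih]
    fin_cases a <;> simp [spin] <;> ring

/-- A function on words has magnetisation `m` if it vanishes on all words of different
magnetisation. -/
def HasMag (m : ℤ) (φ : List (Fin 3) → ℝ) : Prop := ∀ w, mag w ≠ m → φ w = 0

variable {y : ℝ} {φ : List (Fin 3) → ℝ} {m : ℤ}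

lemma charge_eq_zero (y : ℝ) {a b c : Fin 3} (h : spin b + spin c ≠ spin a) :
    charge y a b c = 0 := by
  revert h
  fin_cases a <;> fin_cases b <;> fin_cases c <;> simp [charge, spin]

lemma HasMag.cons (h : HasMag m φ) (a : Fin 3) :
    HasMag (m - spin a) fun w => φ (a :: w) := fun w hw => h _ fun e => hw (by
  rw [mag_cons] at e
  omega)

lemma HasMag.charge_mul (h : HasMag m φ) {a b c : Fin 3} {v w : List (Fin 3)}
    (hv : mag v ≠ m) (hw : mag w - spin b - spin c = mag v - spin a) :
    charge y a b c * φ w = 0 := by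
  by_cases hs : spin b + spin c = spin a
  · rw [h w fun e => hv (by omega), mul_zero]
  · rw [charge_eq_zero y hs, zero_mul]

lemma HasMag.charge_mul' (h : HasMag m φ) {a b c : Fin 3} {v w : List (Fin 3)}
    (hv : mag v ≠ m) (hw : mag v - spin b - spin c = mag w - spin a) :
    charge y a b c * φ w = 0 := by
  by_cases hs : spin b + spin c = spin a
  · rw [h w fun e => hv (by omega), mul_zero]
  · rw [charge_eq_zero y hs, zero_mul]

lemma HasMag.hasMag_del (h : HasMag m φ) : HasMag m fun x => del y x φ := by
  intro x
  induction x generalizing m φ with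
  | nil => simp
  | cons a l ih =>
    intro hx
    have hl : del y l (fun w => φ (a :: w)) = 0 :=
      ih (h.cons a) fun e => hx (by rw [mag_cons]; omega)
    beta_reduce
    rw [del_cons, hl, sub_zero]
    exact Finset.sum_eq_zero fun b _ => Finset.sum_eq_zero fun c _ =>
      h.charge_mul hx (by simp only [mag_cons]; ring)

lemma HasMag.hasMag_ins (h : HasMag m φ) : HasMag m fun x => ins y x φ := by
  intro x
  induction x generalizing m φ with
  | nil => simp
  | cons a l ih =>
    intro hx
    cases l with
    | nil => simp
    | cons b l =>
      have hl : ins y (b :: l) (fun w => φ (a :: w)) = 0 :=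
        ih (h.cons a) fun e => hx (by rw [mag_cons a]; omega)
      beta_reduce
      rw [ins_cons_cons, hl, sub_zero]
      exact Finset.sum_eq_zero fun c _ => h.charge_mul' hx (by simp only [mag_cons]; ring)

lemma HasMag.hasMag_closedIns (h : HasMag m φ) : HasMag m fun x => closedIns y x φ := by
  intro x hx
  have hi : ins y x φ = 0 := h.hasMag_ins x hx
  beta_reduce
  rw [closedIns, hi, zero_add]
  rcases x with _ | ⟨a, l⟩
  · rfl
  rcases List.eq_nil_or_concat' l with rfl | ⟨l, z, rfl⟩
  · rfl
  rw [wrap_cons_append, Finset.sum_eq_zero, mul_zero]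
  refine fun c _ => h.charge_mul' hx ?_
  simp only [mag_cons, mag_append, mag_nil]
  ring

lemma hasMag_zeroWord (N : ℕ) : HasMag 0 (zeroWord N) := fun w hw =>
  if_neg fun e => hw (by simp [e, mag, spin])

lemma hasMag_alternating (N : ℕ) : HasMag 0 (alternating N) := fun w hw =>
  if_neg fun e => hw (by rw [mag_eq_count_sub, e.2.2, sub_self])

end Magnetisation

section ZeroMode

/-- A cocycle that is not a coboundary can be replaced by one in the kernel of the supercharge. -/
lemma exists_zero_mode_of_not_exact {y : ℝ} {n : ℕ} {c : List (Fin 3) → ℝ}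
    (hc : TwistedCyclic c) (hm : HasMag 0 c) (hd : ∀ x, del y x c = 0)
    (hne : ∀ w, TwistedCyclic w → ∃ x : List (Fin 3), x.length = n + 1 ∧ del y x w ≠ c x) :
    ∃ v, TwistedCyclic v ∧ HasMag 0 v ∧ (∀ x, del y x v = 0) ∧
      (∀ x : List (Fin 3), x.length = n + 2 → closedIns y x v = 0) ∧
      ∃ x : List (Fin 3), x.length = n + 1 ∧ v x ≠ 0 := by
  let r : (List (Fin 3) → ℝ) → EuclideanSpace ℝ (Fin (n + 1) → Fin 3) :=
    fun φ => WithLp.toLp 2 fun σ => φ (List.ofFn σ)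
  let K : Submodule ℝ (EuclideanSpace ℝ (Fin (n + 1) → Fin 3)) :=
    { carrier := {k | ∃ w, TwistedCyclic w ∧ HasMag 0 w ∧ r (fun x => del y x w) = k}
      zero_mem' := ⟨fun _ => 0, fun a l => by simp, fun w _ => rfl, by
        simp only [del_zero]; rfl⟩
      add_mem' := by
        rintro _ _ ⟨v, hv, hv', rfl⟩ ⟨w, hw, hw', rfl⟩
        refine ⟨fun x => v x + w x, fun a l => by beta_reduce; rw [hv, hw]; ring,
          fun x hx => by beta_reduce; rw [hv' x hx, hw' x hx, add_zero], ?_⟩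
        simp only [del_add]
        rfl
      smul_mem' := by
        rintro s _ ⟨w, hw, hw', rfl⟩
        refine ⟨fun x => s * w x, fun a l => by beta_reduce; rw [hw]; ring,
          fun x hx => by beta_reduce; rw [hw' x hx, mul_zero], ?_⟩
        simp only [del_mul]
        rfl }
  obtain ⟨k, ⟨w, hw, hw', rfl⟩, u, hu, hku⟩ := K.exists_add_mem_mem_orthogonal (r c)
  let v : List (Fin 3) → ℝ := fun x => c x - del y x w
  have hv : TwistedCyclic v := fun a l => by
    have h : del y (a :: l) w = (-1) ^ l.length * twist a * del y (l ++ [a]) w :=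
      hw.cyclic_del a l
    simp only [v]
    rw [hc, h]
    ring
  have hv' : HasMag 0 v := fun x hx => by
    have h : del y x w = 0 := hw'.hasMag_del x hx
    simp only [v]
    rw [hm x hx, h, sub_zero]
  have huv : u = r v := by
    rw [← sub_eq_iff_eq_add'.mpr hku]
    rfl
  refine ⟨v, hv, hv', fun x => ?_, fun x hx => ?_, ?_⟩
  · simp only [v, del_sub, hd, hw.del_del_eq_zero, sub_zero]
  · refine hv.closedIns_eq_zero ?_ hx
    have h := (Submodule.mem_orthogonal K u).mp hu _ ⟨fun x => closedIns y x v,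
      hv.cyclic_closedIns, hv'.hasMag_closedIns, rfl⟩
    rw [wordSum_eq_sum_ofFn, ← h, huv]
    simp [r, PiLp.inner_apply]
  · obtain ⟨x, hx, hx'⟩ := hne w hw
    exact ⟨x, hx, fun h => hx' (sub_eq_zero.mp h).symm⟩

lemma exists_zero_mode {y : ℝ} (hy : y ≠ 0) (n : ℕ) :
    ∃ v, TwistedCyclic v ∧ HasMag 0 v ∧ (∀ x, del y x v = 0) ∧
      (∀ x : List (Fin 3), x.length = n + 2 → closedIns y x v = 0) ∧
      ∃ x : List (Fin 3), x.length = n + 1 ∧ v x ≠ 0 := by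
  rcases Nat.even_or_odd' (n + 1) with ⟨m, hm | hm⟩
  · refine exists_zero_mode_of_not_exact (c := alternating (n + 1)) ?_ (hasMag_alternating _)
      (del_alternating y _) ?_
    · exact hm ▸ twistedCyclic_alternating m
    · exact fun w _ => hm ▸ exists_del_ne_alternating y w m
  · refine exists_zero_mode_of_not_exact (c := zeroWord (n + 1)) ?_ (hasMag_zeroWord _)
      (del_zeroWord y _) ?_
    · exact hm ▸ twistedCyclic_zeroWord m
    · exact fun w hw => hm ▸ hw.exists_del_ne_zeroWord hy m

end ZeroMode

section Local

/-- The spin matrices up to normalisation. -/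
def intSpin : Fin 3 → Fin 3 → Fin 3 → ℝ :=
  ![![![0, 1, 0], ![1, 0, 1], ![0, 1, 0]],
    ![![0, -1, 0], ![1, 0, -1], ![0, 1, 0]],
    ![![1, 0, 0], ![0, 0, 0], ![0, 0, -1]]]

/-- The squares of the normalisation factors relating `sMat` to `intSpin`. -/
def spinNorm : Fin 3 → ℝ := ![1 / 2, -1 / 2, 1]

lemma exists_sMat_eq : ∃ f : Fin 3 → ℂ, (∀ a, f a * f a = spinNorm a) ∧
    ∀ a p q, sMat a p q = f a * intSpin a p q := by
  have h : (Real.sqrt 2 : ℂ)⁻¹ * (Real.sqrt 2 : ℂ)⁻¹ = 1 / 2 := by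
    rw [← mul_inv, ← Complex.ofReal_mul, Real.mul_self_sqrt zero_le_two]
    simp
  refine ⟨![(Real.sqrt 2 : ℂ)⁻¹, (Real.sqrt 2 : ℂ)⁻¹ * Complex.I, 1], fun a => ?_,
    fun a p q => ?_⟩
  · fin_cases a
    · simpa [spinNorm] using h
    · have e : (Real.sqrt 2 : ℂ)⁻¹ * Complex.I * ((Real.sqrt 2 : ℂ)⁻¹ * Complex.I) = -1 / 2 := by
        linear_combination Complex.I * Complex.I * h + 1 / 2 * Complex.I_mul_I
      simpa [spinNorm] using e
    · simp [spinNorm]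
  · fin_cases a <;> fin_cases p <;> fin_cases q <;> simp [sMat, intSpin]

/-- The couplings `J`, as real numbers. -/
def realJ (x : ℝ) : Fin 3 → ℝ := ![1, 1, (x ^ 2 - 2) / 2]

/-- The couplings `A`, as real numbers. -/
def realA (x : ℝ) : Fin 3 → Fin 3 → ℝ :=
  ![![1, 1, x - 1], ![1, 1, x - 1], ![x - 1, x - 1, (x ^ 2 - 2) / 2]]

set_option maxHeartbeats 1000000 in
lemma bond_eq (x : ℝ) (u w q t : Fin 3) :
    (∑ a, realJ x a * (spinNorm a * (intSpin a u q * intSpin a w t + 2 *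
      ((∑ p, intSpin a u p * intSpin a p q) * if w = t then 1 else 0))))
    - (∑ a, ∑ b, realA x a b * (spinNorm a * spinNorm b *
      ((∑ p, intSpin a u p * intSpin b p q) * ∑ r, intSpin a w r * intSpin b r t))) =
    bond (-x / 2) u w q t := by
  fin_cases u <;> fin_cases w <;> fin_cases q <;> fin_cases t <;>
    simp [Fin.sum_univ_three, intSpin, spinNorm, realJ, realA, bond, hop, charge, sqSpin] <;> ring

lemma bond_eq_sMat (x : ℝ) (u w q t : Fin 3) :
    (∑ a, Jc x a * (sMat a u q * sMat a w t + 2 *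
      ((∑ p, sMat a u p * sMat a p q) * if w = t then 1 else 0)))
    - (∑ a, ∑ b, Ac x a b *
      ((∑ p, sMat a u p * sMat b p q) * ∑ r, sMat a w r * sMat b r t)) =
    bond (-x / 2) u w q t := by
  obtain ⟨f, hf, hs⟩ := exists_sMat_eq
  have hJ : ∀ a, Jc x a = realJ x a := by
    intro a
    fin_cases a <;> simp [Jc, realJ]
  have hA : ∀ a b, Ac x a b = realA x a b := by
    intro a b
    fin_cases a <;> fin_cases b <;> simp [Ac, realA]
  have hsum : ∀ a b u q, ∑ p, sMat a u p * sMat b p q =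
      f a * f b * ((∑ p, intSpin a u p * intSpin b p q : ℝ) : ℂ) := by
    intro a b u q
    push_cast
    rw [Finset.mul_sum]
    exact Finset.sum_congr rfl fun p _ => by rw [hs, hs]; ring
  rw [← bond_eq, Complex.ofReal_sub, Complex.ofReal_sum, Complex.ofReal_sum]
  simp only [hsum]
  simp only [hs, hJ, hA]
  congr 1
  · refine Finset.sum_congr rfl fun a _ => ?_
    rw [Complex.ofReal_mul, Complex.ofReal_mul, ← hf]
    simp only [Complex.ofReal_mul, Complex.ofReal_add, Complex.ofReal_ofNat]
    split_ifs <;> simp only [Complex.ofReal_one, Complex.ofReal_zero] <;> ring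
  · refine Finset.sum_congr rfl fun a _ => ?_
    rw [Complex.ofReal_sum]
    refine Finset.sum_congr rfl fun b _ => ?_
    simp only [Complex.ofReal_mul, ← hf]
    ring

end Local

section Operators

variable {N : ℕ}

lemma siteOp_mulVec (m : Matrix (Fin 3) (Fin 3) ℂ) (j : Fin N) (V : (Fin N → Fin 3) → ℂ)
    (σ : Fin N → Fin 3) :
    (siteOp m j *ᵥ V) σ = ∑ p, m (σ j) p * V (Function.update σ j p) := by
  symm
  rw [Matrix.mulVec, dotProduct]
  refine Finset.sum_of_injOn (fun p => Function.update σ j p)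
    (Function.update_injective σ j).injOn (by simp) (fun τ _ hτ => ?_) fun p _ => ?_
  · rw [siteOp, Matrix.of_apply, if_neg, mul_zero, zero_mul]
    intro h
    refine hτ ⟨τ j, by simp, funext fun k => ?_⟩
    by_cases hk : k = j
    · subst hk; simp
    · simp [hk, h k hk]
  · rw [siteOp, Matrix.of_apply, if_pos, mul_one, Function.update_self]
    intro k hk
    rw [Function.update_of_ne hk]

lemma siteOp_mulVec_siteOp_self (m m' : Matrix (Fin 3) (Fin 3) ℂ) (j : Fin N)
    (V : (Fin N → Fin 3) → ℂ) :
    siteOp m j *ᵥ (siteOp m' j *ᵥ V) = siteOp (m * m') j *ᵥ V := by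
  funext σ
  simp only [siteOp_mulVec, Function.update_self, Function.update_idem, Finset.mul_sum,
    Matrix.mul_apply, Finset.sum_mul]
  rw [Finset.sum_comm]
  exact Finset.sum_congr rfl fun p _ => Finset.sum_congr rfl fun q _ => by ring

lemma siteOp_mulVec_siteOp (m m' : Matrix (Fin 3) (Fin 3) ℂ) {j k : Fin N} (hjk : k ≠ j)
    (V : (Fin N → Fin 3) → ℂ) (σ : Fin N → Fin 3) :
    (siteOp m j *ᵥ (siteOp m' k *ᵥ V)) σ =
      ∑ q, ∑ t, (m (σ j) q * m' (σ k) t) *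
        V (Function.update (Function.update σ j q) k t) := by
  simp only [siteOp_mulVec, Function.update_of_ne hjk, Finset.mul_sum, mul_assoc]

lemma siteOp_mulVec_eq_sum (m : Matrix (Fin 3) (Fin 3) ℂ) {j k : Fin N} (hjk : k ≠ j)
    (V : (Fin N → Fin 3) → ℂ) (σ : Fin N → Fin 3) :
    (siteOp m j *ᵥ V) σ = ∑ q, ∑ t, (m (σ j) q * if σ k = t then 1 else 0) *
      V (Function.update (Function.update σ j q) k t) := by
  rw [siteOp_mulVec]
  refine Finset.sum_congr rfl fun q _ => ?_
  have h : Function.update (Function.update σ j q) k (σ k) = Function.update σ j q := by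
    rw [Function.update_eq_self_iff, Function.update_of_ne hjk]
  simp [h]

/-- The spin matrices, conjugated by a diagonal matrix. -/
def conjSpin (d : Fin 3 → ℝ) (a : Fin 3) : Matrix (Fin 3) (Fin 3) ℂ :=
  Matrix.of fun p q => d p * sMat a p q * d q

lemma conjSpin_mul (d : Fin 3 → ℝ) (hd : ∀ p, d p * d p = 1) (a b p q : Fin 3) :
    (conjSpin d a * conjSpin d b) p q = d p * d q * ∑ r, sMat a p r * sMat b r q := by
  rw [Matrix.mul_apply, Finset.mul_sum]
  refine Finset.sum_congr rfl fun r _ => ?_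
  have h : (d r : ℂ) * d r = 1 := by exact_mod_cast hd r
  simp only [conjSpin, Matrix.of_apply]
  linear_combination (d p * sMat a p r * sMat b r q * d q) * h

/-- The action of a two-site term of the Hamiltonian. -/
lemma pair_mulVec (x : ℝ) (d : Fin 3 → ℝ) (hd : ∀ p, d p * d p = 1) {j k : Fin N} (hjk : k ≠ j)
    (V : (Fin N → Fin 3) → ℂ) (σ : Fin N → Fin 3) :
    (((∑ a : Fin 3, Jc x a • (sAt a j * siteOp (conjSpin d a) k
        + (2 : ℂ) • (sAt a j * sAt a j)))
      - ∑ a : Fin 3, ∑ b : Fin 3,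
          Ac x a b • (sAt a j * sAt b j * siteOp (conjSpin d a) k * siteOp (conjSpin d b) k))
      *ᵥ V) σ =
    ∑ q, ∑ t, ((bond (-x / 2) (σ j) (σ k) q t * (d (σ k) * d t) : ℝ) : ℂ) *
      V (Function.update (Function.update σ j q) k t) := by
  have hadd : ∀ c c' W : Fin 3 → Fin 3 → ℂ, (∑ q, ∑ t, c q t * W q t)
      + ∑ q, ∑ t, c' q t * W q t = ∑ q, ∑ t, (c q t + c' q t) * W q t := by
    intro c c' W
    simp only [add_mul, Finset.sum_add_distrib]
  have hsub : ∀ c c' W : Fin 3 → Fin 3 → ℂ, (∑ q, ∑ t, c q t * W q t)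
      - ∑ q, ∑ t, c' q t * W q t = ∑ q, ∑ t, (c q t - c' q t) * W q t := by
    intro c c' W
    simp only [sub_mul, Finset.sum_sub_distrib]
  have hmul : ∀ (r : ℂ) (c W : Fin 3 → Fin 3 → ℂ), r * ∑ q, ∑ t, c q t * W q t =
      ∑ q, ∑ t, r * c q t * W q t := by
    intro r c W
    simp only [Finset.mul_sum, mul_assoc]
  have hsum : ∀ (c : Fin 3 → Fin 3 → Fin 3 → ℂ) (W : Fin 3 → Fin 3 → ℂ),
      ∑ a, ∑ q, ∑ t, c a q t * W q t = ∑ q, ∑ t, (∑ a, c a q t) * W q t := by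
    intro c W
    rw [Finset.sum_comm]
    refine Finset.sum_congr rfl fun q _ => ?_
    rw [Finset.sum_comm]
    simp only [Finset.sum_mul]
  simp only [sAt, Matrix.sub_mulVec, Matrix.sum_mulVec, Matrix.smul_mulVec, Matrix.add_mulVec,
    Matrix.mul_assoc, ← Matrix.mulVec_mulVec, siteOp_mulVec_siteOp_self, Pi.sub_apply,
    Finset.sum_apply, Pi.smul_apply, Pi.add_apply, smul_eq_mul]
  simp only [siteOp_mulVec_siteOp _ _ hjk, siteOp_mulVec_eq_sum _ hjk]
  simp only [hmul, hadd, hsum, hsub]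
  refine Finset.sum_congr rfl fun q _ => Finset.sum_congr rfl fun t _ => ?_
  congr 1
  rw [Complex.ofReal_mul, ← bond_eq_sMat, sub_mul, Finset.sum_mul, Finset.sum_mul]
  congr 1
  · refine Finset.sum_congr rfl fun a _ => ?_
    rw [Matrix.mul_apply, conjSpin, Matrix.of_apply]
    split_ifs with h
    · have hd' : (d (σ k) : ℂ) * d t = 1 := by rw [← h]; exact_mod_cast hd (σ k)
      push_cast
      linear_combination (-2 * Jc x a * ∑ p, sMat a (σ j) p * sMat a p q) * hd'
    · push_cast
      ring
  · refine Finset.sum_congr rfl fun a _ => ?_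
    rw [Finset.sum_mul]
    refine Finset.sum_congr rfl fun b _ => ?_
    rw [conjSpin_mul d hd, Matrix.mul_apply]
    push_cast
    ring

end Operators

section Chain

variable {n : ℕ}

lemma sNext_castSucc (a : Fin 3) (j : Fin (n + 1)) :
    sNext a j.castSucc = siteOp (conjSpin (fun _ => 1) a) j.succ := by
  have h : conjSpin (fun _ => 1) a = sMat a := by
    ext p q
    simp [conjSpin]
  rw [sNext, dif_pos (by have := j.isLt; rw [Fin.val_castSucc]; omega), h]
  rfl

lemma sNext_last (a : Fin 3) :
    sNext a (Fin.last (n + 1)) = siteOp (conjSpin twist a) 0 := by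
  have h : conjSpin twist a = (if a = 2 then (1 : ℂ) else -1) • sMat a := by
    ext p q
    fin_cases a <;> fin_cases p <;> fin_cases q <;> simp [conjSpin, twist, sMat]
  rw [sNext, dif_neg (by simp), h]
  ext σ τ
  simp only [siteOp, Matrix.smul_apply, Matrix.of_apply, smul_eq_mul, mul_assoc]
  rfl

lemma Hxxz_mulVec (x : ℝ) (V : (Fin (n + 2) → Fin 3) → ℂ) (σ : Fin (n + 2) → Fin 3) :
    (Hxxz (n + 2) x *ᵥ V) σ =
      (∑ j : Fin (n + 1), ∑ q, ∑ t, (bond (-x / 2) (σ j.castSucc) (σ j.succ) q t : ℂ) *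
        V (Function.update (Function.update σ j.castSucc q) j.succ t)) +
      ∑ q, ∑ t, ((bond (-x / 2) (σ (Fin.last (n + 1))) (σ 0) q t *
          (twist (σ 0) * twist t) : ℝ) : ℂ) *
        V (Function.update (Function.update σ (Fin.last (n + 1)) q) 0 t) := by
  rw [Hxxz, Fin.sum_univ_castSucc, Matrix.add_mulVec, Matrix.sum_mulVec, Pi.add_apply,
    Finset.sum_apply]
  simp only [sNext_castSucc, sNext_last]
  rw [pair_mulVec x twist twist_mul_self (Fin.last_pos.ne)]
  congr 1
  refine Finset.sum_congr rfl fun j _ => ?_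
  rw [pair_mulVec x (fun _ => 1) (fun _ => one_mul 1) (Fin.castSucc_lt_succ).ne']
  simp

lemma openEnergy_ofFn (y : ℝ) (σ : Fin (n + 1) → Fin 3) : ∀ φ : List (Fin 3) → ℝ,
    openEnergy y (List.ofFn σ) φ =
      ∑ j : Fin n, ∑ q, ∑ t, bond y (σ j.castSucc) (σ j.succ) q t *
        φ (List.ofFn (Function.update (Function.update σ j.castSucc q) j.succ t)) := by
  induction n with
  | zero => intro φ; simp [openEnergy]
  | succ n ih =>
    intro φ
    have h := ih (fun i => σ i.succ) fun w => φ (σ 0 :: w)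
    rw [List.ofFn_succ] at h
    rw [List.ofFn_succ, List.ofFn_succ, openEnergy, h, Fin.sum_univ_succ (n := n)]
    have hs : ∀ (τ : Fin (n + 2) → Fin 3) (k : Fin (n + 1)) (t : Fin 3),
        (fun i : Fin (n + 1) => Function.update τ k.succ t i.succ) =
          Function.update (fun i => τ i.succ) k t := fun τ k t =>
      Function.update_comp_eq_of_injective τ (Fin.succ_injective _) k t
    congr 1
    · refine Finset.sum_congr rfl fun q _ => Finset.sum_congr rfl fun t _ => ?_
      congr 2
      rw [List.ofFn_succ (f := Function.update _ _ _), hs, List.ofFn_succ]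
      simp [Function.update_of_ne]
    · refine Finset.sum_congr rfl fun j _ => Finset.sum_congr rfl fun q _ =>
        Finset.sum_congr rfl fun t _ => ?_
      congr 2
      rw [List.ofFn_succ (f := Function.update (Function.update σ _ _) _ _), hs, ← Fin.succ_castSucc, hs]
      simp [Function.update_of_ne, (Fin.succ_ne_zero _).symm]

lemma ofFn_eq_cons_append (σ : Fin (n + 2) → Fin 3) :
    List.ofFn σ = σ 0 :: (List.ofFn (fun i : Fin n => σ i.castSucc.succ)
      ++ [σ (Fin.last (n + 1))]) := by
  rw [List.ofFn_succ, List.ofFn_succ', List.concat_eq_append]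
  rfl

lemma Hxxz_mulVec_eq_zero {x : ℝ} {φ : List (Fin 3) → ℝ} (hφ : TwistedCyclic φ)
    (hd : ∀ l, del (-x / 2) l φ = 0)
    (hc : ∀ l : List (Fin 3), l.length = n + 3 → closedIns (-x / 2) l φ = 0) :
    Hxxz (n + 2) x *ᵥ (fun σ => (φ (List.ofFn σ) : ℂ)) = 0 := by
  funext σ
  have h := hφ.openEnergy_add_eq_zero hd (σ 0) (σ (Fin.last (n + 1)))
    (List.ofFn fun i : Fin n => σ i.castSucc.succ) (by simpa using hc)
  rw [← ofFn_eq_cons_append, openEnergy_ofFn] at h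
  rw [Hxxz_mulVec, Pi.zero_apply, ← Complex.ofReal_zero, ← h]
  push_cast
  congr 1
  refine Finset.sum_congr rfl fun q _ => Finset.sum_congr rfl fun t _ => ?_
  rw [ofFn_eq_cons_append (Function.update _ _ _)]
  have h0 : ∀ i : Fin n, i.castSucc.succ ≠ Fin.last (n + 1) := fun i => by
    rw [← Fin.succ_last]
    exact fun e => (Fin.castSucc_lt_last i).ne (Fin.succ_injective _ e)
  have h1 : Fin.last (n + 1) ≠ 0 := Fin.last_pos.ne'
  simp only [Function.update_self, Function.update_of_ne h1, Function.update_of_ne (h0 _),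
    Function.update_of_ne (Fin.succ_ne_zero _)]

lemma magnetisation_mulVec_eq_zero {N : ℕ} {φ : List (Fin 3) → ℝ} (hφ : HasMag 0 φ) :
    magnetisation N *ᵥ (fun σ => (φ (List.ofFn σ) : ℂ)) = 0 := by
  funext σ
  have hs : ∀ (a : Fin 3) (f : Fin 3 → ℂ), ∑ p, sMat 2 a p * f p = spin a * f a := by
    intro a f
    fin_cases a <;> simp [sMat, spin, Fin.sum_univ_three]
  simp only [magnetisation, Matrix.sum_mulVec, Finset.sum_apply, sAt, siteOp_mulVec, hs,
    Function.update_eq_self, ← Finset.sum_mul, Pi.zero_apply]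
  by_cases h : mag (List.ofFn σ) = 0
  · rw [mag, List.map_ofFn, List.sum_ofFn] at h
    have h' : ∑ i, (spin (σ i) : ℂ) = 0 := by exact_mod_cast h
    rw [h', zero_mul]
  · rw [hφ _ h, Complex.ofReal_zero, mul_zero]

lemma Sprime_mulVec (d : Fin 3 → ℂ) (V : (Fin (n + 1) → Fin 3) → ℂ) (σ : Fin (n + 1) → Fin 3) :
    (Sprime (n + 1) d *ᵥ V) σ = d (σ 0) * V fun j => σ (finRotate (n + 1) j) := by
  have h : (∏ j : Fin (n + 1), if (finRotate (n + 1) j).val = 0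
      then d (σ (finRotate (n + 1) j)) else 1) = d (σ 0) := by
    rw [Equiv.prod_comp (finRotate (n + 1)) fun k => if k.val = 0 then d (σ k) else 1,
      Fin.prod_univ_succ]
    simp
  simp only [Matrix.mulVec, dotProduct, Sprime, Matrix.of_apply, ite_mul, zero_mul]
  rw [Finset.sum_ite_eq' Finset.univ, if_pos (Finset.mem_univ _), h]

lemma Sprime_mulVec_eq {φ : List (Fin 3) → ℝ} (hφ : TwistedCyclic φ) :
    Sprime (n + 1) ![-1, 1, -1] *ᵥ (fun σ => (φ (List.ofFn σ) : ℂ)) =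
      (-1 : ℂ) ^ (n + 1 + 1) • fun σ => (φ (List.ofFn σ) : ℂ) := by
  funext σ
  have h1 : (List.ofFn fun j => σ (finRotate (n + 1) j)) =
      List.ofFn (fun i : Fin n => σ i.succ) ++ [σ 0] := by
    rw [List.ofFn_succ', List.concat_eq_append]
    simp
  have h2 : (![-1, 1, -1] : Fin 3 → ℂ) (σ 0) = (twist (σ 0) : ℂ) := by
    generalize σ 0 = a
    fin_cases a <;> simp [twist]
  have h3 : ((-1 : ℂ) ^ n) * (-1) ^ n = 1 := by exact_mod_cast neg_one_pow_mul_self n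
  rw [Sprime_mulVec, h1, h2, Pi.smul_apply, smul_eq_mul, List.ofFn_succ, hφ (σ 0),
    List.length_ofFn, pow_succ, pow_succ]
  push_cast
  linear_combination (-(twist (σ 0) : ℂ) *
    φ (List.ofFn (fun i : Fin n => σ i.succ) ++ [σ 0])) * h3

lemma continuous_Hxxz (N : ℕ) : Continuous (Hxxz N) := by
  have hJ : ∀ a, Continuous fun x => Jc x a := by
    intro a
    fin_cases a <;> simp only [Jc] <;> fun_prop
  have hA : ∀ a b, Continuous fun x => Ac x a b := by
    intro a b
    fin_cases a <;> fin_cases b <;> simp only [Ac] <;> fun_prop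
  unfold Hxxz
  fun_prop

/-- The parameters for which a given family of linear equations has a nonzero solution form a
closed set. -/
lemma isClosed_setOf_exists_mulVec_eq_zero {ι : Type*} [Fintype ι] {M : ℝ → Matrix ι ι ℂ}
    (hM : Continuous M) {S : Set (ι → ℂ)} (hS : IsClosed S)
    (hsmul : ∀ (r : ℝ) (v : ι → ℂ), v ∈ S → r • v ∈ S) :
    IsClosed {x | ∃ v ∈ S, v ≠ 0 ∧ M x *ᵥ v = 0} := by
  have h : {x | ∃ v ∈ S, v ≠ 0 ∧ M x *ᵥ v = 0} =
      Prod.fst '' {p : ℝ × Metric.sphere (0 : ι → ℂ) 1 |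
        (p.2 : ι → ℂ) ∈ S ∧ M p.1 *ᵥ (p.2 : ι → ℂ) = 0} := by
    ext x
    constructor
    · rintro ⟨v, hv, h0, h⟩
      refine ⟨(x, ⟨‖v‖⁻¹ • v, ?_⟩), ⟨hsmul _ v hv, ?_⟩, rfl⟩
      · simp [norm_smul, h0]
      · simp [Matrix.mulVec_smul, h]
    · rintro ⟨⟨x, v⟩, ⟨hv, h⟩, rfl⟩
      exact ⟨v, hv, Metric.ne_of_mem_sphere v.2 one_ne_zero, h⟩
  rw [h]
  refine isClosedMap_fst_of_compactSpace _ (IsClosed.inter ?_ ?_)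
  · exact hS.preimage (continuous_subtype_val.comp continuous_snd)
  · exact isClosed_eq ((hM.comp continuous_fst).matrix_mulVec
      (continuous_subtype_val.comp continuous_snd)) continuous_const

end Chain

/-- For every N > 1 and twist angle φ = π, the Hamiltonian possesses a zero-energy state of
zero magnetisation in the eigenspace of `S'` with eigenvalue `(−1)^{N+1}`. -/
theorem stmt0 (N : ℕ) (hN : 1 < N) (x : ℝ) :
    ∃ v : (Fin N → Fin 3) → ℂ, v ≠ 0 ∧
      (Hxxz N x).mulVec v = 0 ∧
      (magnetisation N).mulVec v = 0 ∧
      (Sprime N ![-1, 1, -1]).mulVec v = ((-1 : ℂ)^(N+1)) • v := by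
  obtain ⟨n, rfl⟩ : ∃ n, N = n + 2 := ⟨N - 2, by omega⟩
  let S : Set ((Fin (n + 2) → Fin 3) → ℂ) := {v | magnetisation (n + 2) *ᵥ v = 0 ∧
    Sprime (n + 2) ![-1, 1, -1] *ᵥ v = (-1 : ℂ) ^ (n + 2 + 1) • v}
  have hS : IsClosed S := (isClosed_eq (by fun_prop) (by fun_prop)).inter
    (isClosed_eq (by fun_prop) (by fun_prop))
  have hclosed := isClosed_setOf_exists_mulVec_eq_zero (continuous_Hxxz (n + 2)) hS
    fun r v hv => ⟨by rw [Matrix.mulVec_smul, hv.1, smul_zero],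
      by rw [Matrix.mulVec_smul, hv.2, smul_comm]⟩
  have hne : ({0}ᶜ : Set ℝ) ⊆ {x | ∃ v ∈ S, v ≠ 0 ∧ Hxxz (n + 2) x *ᵥ v = 0} := by
    intro x hx
    have hx' : x ≠ 0 := hx
    obtain ⟨φ, hφ, hm, hd, hc, w, hw, hw'⟩ :=
      exists_zero_mode (y := -x / 2) (by simpa using hx') (n + 1)
    refine ⟨fun σ => (φ (List.ofFn σ) : ℂ), ⟨magnetisation_mulVec_eq_zero hm,
      Sprime_mulVec_eq hφ⟩, fun h => hw' ?_, Hxxz_mulVec_eq_zero hφ hd hc⟩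
    have hσ : List.ofFn (fun i : Fin (n + 2) => w.get (i.cast hw.symm)) = w :=
      List.ext_getElem (by simp [hw]) fun i _ _ => by
        rw [List.getElem_ofFn]; rfl
    have h' := congrFun h fun i => w.get (i.cast hw.symm)
    rw [hσ] at h'
    exact Complex.ofReal_eq_zero.mp h'
  have hx : x ∈ {x | ∃ v ∈ S, v ≠ 0 ∧ Hxxz (n + 2) x *ᵥ v = 0} :=
    hclosed.closure_subset_iff.mpr hne (dense_compl_singleton (0 : ℝ) x)
  obtain ⟨v, hv, h0, h⟩ := hx
  exact ⟨v, h0, h, hv.1, hv.2⟩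

end
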